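/- arXiv:1907.03303 — 9 statements merged into one kernel-verified Lean document; each statement's English description precedes it below -/
import Mathlib

section
/- Density of solvable parameters for a special polynomial equation: Let a > b ≥ 1 be coprime integers and α_b, α_{b+1},…,α_a be integers with |α_b| = 1. Then for every δ > 0 there exists N_δ such that for all N > N_δ, the number of integers n ∈ [1,N] for which there exists a positive integer m with m^a = Σ_{j=b}^a α_j n^j N^{a−j} is at most δ·N. -/
lemma aux_structure
    (a b : ℕ) (hba : b < a) (hcop : Nat.Coprime a b)
    (α : ℕ → ℤ) (hαb : |α b| = 1) (n N m : ℕ) (hn : 1 ≤ n)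
    (h : (m : ℤ) ^ a = ∑ j ∈ Finset.Icc b a, α j * (n : ℤ) ^ j * (N : ℤ) ^ (a - j)) :
    ∃ d k : ℕ, d ∣ N ∧ n = d * k ^ a := by
  obtain ⟨n', N', hc, hn', hN'⟩ := Nat.exists_coprime n N
  set d := Nat.gcd n N with hd
  have hdpos : 0 < d := Nat.gcd_pos_of_pos_left _ hn
  have hsum : (m : ℤ) ^ a = (d : ℤ) ^ a *
      ∑ j ∈ Finset.Icc b a, α j * (n' : ℤ) ^ j * (N' : ℤ) ^ (a - j) := by
    rw [h, Finset.mul_sum]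
    refine Finset.sum_congr rfl fun j hj => ?_
    have hj' := (Finset.mem_Icc.1 hj).2
    have e : (d : ℤ) ^ a = (d : ℤ) ^ j * (d : ℤ) ^ (a - j) := by
      rw [← pow_add]; congr 1; omega
    rw [e, hn', hN']; push_cast; ring
  have hdm : d ∣ m := by
    have : (d : ℤ) ^ a ∣ (m : ℤ) ^ a := ⟨_, hsum⟩
    have h2 : d ^ a ∣ m ^ a := by exact_mod_cast this
    exact (Nat.pow_dvd_pow_iff (by omega)).1 h2
  obtain ⟨m', rfl⟩ := hdm
  have hd0 : (d : ℤ) ^ a ≠ 0 := pow_ne_zero _ (by exact_mod_cast hdpos.ne')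
  have h1 : (m' : ℤ) ^ a = ∑ j ∈ Finset.Icc b a, α j * (n' : ℤ) ^ j * (N' : ℤ) ^ (a - j) := by
    apply mul_left_cancel₀ hd0
    rw [← hsum]; push_cast; ring
  set R : ℤ := ∑ j ∈ Finset.Ioc b a, α j * (n' : ℤ) ^ (j - b - 1) * (N' : ℤ) ^ (a - j) with hR
  have h2 : (n' : ℤ) ^ b * (α b * (N' : ℤ) ^ (a - b) + n' * R) = (m' : ℤ) ^ a := by
    rw [h1, ← Finset.Ioc_insert_left hba.le, Finset.sum_insert (by simp), mul_add, hR,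
      Finset.mul_sum, Finset.mul_sum]
    congr 1
    · ring
    · refine Finset.sum_congr rfl fun j hj => ?_
      have hj' := (Finset.mem_Ioc.1 hj).1
      have e : (n' : ℤ) ^ j = (n' : ℤ) ^ b * ((n' : ℤ) * (n' : ℤ) ^ (j - b - 1)) := by
        rw [← pow_succ', ← pow_add]; congr 1; omega
      rw [e]; ring
  have hcZ : IsCoprime (n' : ℤ) (N' : ℤ) := Nat.isCoprime_iff_coprime.2 hc
  have hu : IsUnit (α b) := Int.isUnit_iff_abs_eq.2 hαb
  have hc1 : IsCoprime (n' : ℤ) (α b * (N' : ℤ) ^ (a - b) + n' * R) := by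
    apply IsCoprime.add_mul_left_right
    exact (isCoprime_mul_unit_left_right hu _ _).2 hcZ.pow_right
  have hc2 : IsCoprime ((n' : ℤ) ^ b) (α b * (N' : ℤ) ^ (a - b) + n' * R) := hc1.pow_left
  obtain ⟨c, hcc⟩ := exists_associated_pow_of_mul_eq_pow' hc2 h2
  have h3 : n' ^ b = c.natAbs ^ a := by
    have := Int.natAbs_eq_iff_associated.2 hcc
    simpa [Int.natAbs_pow] using this.symm
  have h3Q : (n' : ℚ) ^ b = (c.natAbs : ℚ) ^ a := by exact_mod_cast h3
  obtain ⟨q, hq, -⟩ := (pow_eq_pow_iff_of_coprime hcop.symm).1 h3Q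
  obtain ⟨k, hk⟩ : ∃ k : ℕ, n' = k ^ a := by
    refine ⟨q.num.natAbs, ?_⟩
    have := congrArg (fun x : ℚ => x.num.natAbs) hq
    simpa [Rat.num_pow, Int.natAbs_pow] using this
  refine ⟨d, k, Nat.gcd_dvd_right _ _, ?_⟩
  rw [← hk, mul_comm]; exact hn'

lemma aux_divisors (N : ℕ) : N.divisors.card ≤ 2 * Nat.sqrt N := by
  have : N.divisors ⊆ Finset.Icc 1 N.sqrt ∪ (Finset.Icc 1 N.sqrt).image (fun d => N / d) := by
    intro d hd
    obtain ⟨⟨e, he⟩, h0⟩ := Nat.mem_divisors.1 hd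
    have hd0 : 0 < d := Nat.pos_of_mem_divisors hd
    have he0 : 0 < e := by
      rcases Nat.eq_zero_or_pos e with h | h
      · subst h; simp at he; exact absurd he h0
      · exact h
    rw [Finset.mem_union, Finset.mem_image]
    by_cases h : d ≤ N.sqrt
    · left; exact Finset.mem_Icc.2 ⟨hd0, h⟩
    · right
      refine ⟨e, Finset.mem_Icc.2 ⟨he0, ?_⟩, ?_⟩
      · by_contra h'
        push Not at h h'
        have := Nat.lt_succ_sqrt N
        have h4 := Nat.mul_le_mul h h'
        simp only [Nat.succ_eq_add_one] at this h4
        omega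
      · rw [he]; exact Nat.mul_div_cancel _ he0
  calc _ ≤ _ := Finset.card_le_card this
    _ ≤ _ := Finset.card_union_le _ _
    _ ≤ N.sqrt + N.sqrt := by
      gcongr
      · simp
      · exact Finset.card_image_le.trans (by simp)
    _ = _ := by ring


/-- Density of solvable parameters for the special polynomial equation
`m^a = Σ_{j=b}^a α_j n^j N^{a−j}` (Lemma 3.4 of the paper): for every `δ > 0`,
for all sufficiently large `N`, the number of `n ∈ [1,N]` for which the equation
has a positive integer solution `m` is at most `δ·N`. -/
theorem density_solvable_special_equation
    (a b : ℕ) (hb : 1 ≤ b) (hba : b < a) (hcop : Nat.Coprime a b)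
    (α : ℕ → ℤ) (hαb : |α b| = 1) :
    ∀ δ : ℝ, 0 < δ → ∃ N₀ : ℕ, ∀ N : ℕ, N₀ < N →
      ((Set.ncard {n : ℕ | 1 ≤ n ∧ n ≤ N ∧ ∃ m : ℕ, 0 < m ∧
          (m : ℤ) ^ a = ∑ j ∈ Finset.Icc b a, α j * (n : ℤ) ^ j * (N : ℤ) ^ (a - j)} : ℝ))
        ≤ δ * N := by
  intro δ hδ
  obtain ⟨K, hK⟩ := exists_nat_gt (2 / δ)
  have hK0 : (0 : ℝ) < K := lt_trans (by positivity) hK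
  have hKn : K ≠ 0 := by rintro rfl; simp at hK0
  obtain ⟨N₀, hN₀⟩ := exists_nat_gt ((4 * (K + 1) / δ) ^ 2)
  refine ⟨N₀, fun N hN => ?_⟩
  have hNN : (4 * (K + 1) / δ) ^ 2 < (N : ℝ) := hN₀.trans (by exact_mod_cast hN)
  have hNpos : 0 < N := by omega
  set S := {n : ℕ | 1 ≤ n ∧ n ≤ N ∧ ∃ m : ℕ, 0 < m ∧
          (m : ℤ) ^ a = ∑ j ∈ Finset.Icc b a, α j * (n : ℤ) ^ j * (N : ℤ) ^ (a - j)} with hS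
  set A : Finset ℕ := (N.divisors ×ˢ Finset.range (K + 1)).image (fun p => p.1 * p.2 ^ a) with hA
  set B : Finset ℕ := (Finset.Ioc K (max K N)).biUnion
    (fun k => (Finset.Icc 1 (N / k ^ 2)).image (fun d => d * k ^ a)) with hB
  have hsub : S ⊆ ↑(A ∪ B) := by
    rintro n ⟨h1, h2, m, -, hm⟩
    obtain ⟨d, k, hd, hnk⟩ := aux_structure a b hba hcop α hαb n N m h1 hm
    rw [Finset.mem_coe, Finset.mem_union]
    by_cases hk : k ≤ K
    · left
      rw [hA, Finset.mem_image]
      exact ⟨(d, k), Finset.mem_product.2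
        ⟨Nat.mem_divisors.2 ⟨hd, hNpos.ne'⟩, Finset.mem_range.2 (by simpa using Nat.lt_succ_of_le hk)⟩,
        hnk.symm⟩
    · right
      have hd0 : 0 < d := Nat.pos_of_dvd_of_pos hd hNpos
      have hk0 : 0 < k := by omega
      have hk2 : k ^ 2 ≤ k ^ a := Nat.pow_le_pow_right hk0 (by omega)
      have hdk : d * k ^ 2 ≤ N := (Nat.mul_le_mul_left d hk2).trans (hnk ▸ h2)
      have hkN : k ≤ N := by nlinarith
      rw [hB, Finset.mem_biUnion]
      refine ⟨k, Finset.mem_Ioc.2 ⟨by omega, le_max_of_le_right hkN⟩, Finset.mem_image.2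
        ⟨d, Finset.mem_Icc.2 ⟨hd0, (Nat.le_div_iff_mul_le (by positivity)).2 hdk⟩, hnk.symm⟩⟩
  have hcard : S.ncard ≤ A.card + B.card := by
    calc S.ncard ≤ (↑(A ∪ B) : Set ℕ).ncard := Set.ncard_le_ncard hsub (Finset.finite_toSet _)
      _ = (A ∪ B).card := Set.ncard_coe_finset _
      _ ≤ _ := Finset.card_union_le _ _
  have hAc : (A.card : ℝ) ≤ 2 * √N * (K + 1) := by
    have h1 : A.card ≤ 2 * N.sqrt * (K + 1) := by
      refine Finset.card_image_le.trans ?_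
      rw [Finset.card_product, Finset.card_range]
      exact Nat.mul_le_mul_right _ (aux_divisors N)
    have h2 : (A.card : ℝ) ≤ 2 * (N.sqrt : ℝ) * (K + 1) := by exact_mod_cast h1
    refine h2.trans ?_
    gcongr
    exact Real.nat_sqrt_le_real_sqrt
  have hBc : (B.card : ℝ) ≤ N / K := by
    have h1 : B.card ≤ ∑ k ∈ Finset.Ioc K (max K N), N / k ^ 2 := by
      refine Finset.card_biUnion_le.trans (Finset.sum_le_sum fun k _ => ?_)
      exact Finset.card_image_le.trans (by simp)
    have h2 : (B.card : ℝ) ≤ ∑ k ∈ Finset.Ioc K (max K N), (N : ℝ) * ((k : ℝ) ^ 2)⁻¹ := by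
      calc (B.card : ℝ) ≤ ((∑ k ∈ Finset.Ioc K (max K N), N / k ^ 2 : ℕ) : ℝ) := by exact_mod_cast h1
        _ = ∑ k ∈ Finset.Ioc K (max K N), ((N / k ^ 2 : ℕ) : ℝ) := by push_cast; rfl
        _ ≤ _ := by
          refine Finset.sum_le_sum fun k _ => ?_
          refine Nat.cast_div_le.trans (le_of_eq ?_)
          push_cast; rw [div_eq_mul_inv]
    rw [← Finset.mul_sum] at h2
    refine h2.trans ?_
    rw [div_eq_mul_inv]
    gcongr
    refine (sum_Ioc_inv_sq_le_sub hKn (le_max_left _ _)).trans ?_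
    have : (0 : ℝ) ≤ ((max K N : ℕ) : ℝ)⁻¹ := by positivity
    linarith
  have hcard' : (S.ncard : ℝ) ≤ A.card + B.card := by exact_mod_cast hcard
  have hs : 4 * (K + 1) / δ ≤ √(N : ℝ) := Real.le_sqrt_of_sq_le hNN.le
  have hs' : 4 * (K + 1) ≤ √(N : ℝ) * δ := (div_le_iff₀ hδ).1 hs
  have hsq : √(N : ℝ) * √(N : ℝ) = N := Real.mul_self_sqrt (by positivity)
  have e1 : 2 * √(N : ℝ) * (K + 1) ≤ δ / 2 * N := by
    have := mul_le_mul_of_nonneg_left hs' (Real.sqrt_nonneg (N : ℝ))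
    nlinarith
  have e2 : (N : ℝ) / K ≤ δ / 2 * N := by
    rw [div_le_iff₀ hK0]
    have : 2 < K * δ := (div_lt_iff₀ hδ).1 hK
    have hN' : (0 : ℝ) ≤ N := by positivity
    nlinarith
  linarith
end

section
/- Structure of solutions with coprime parameter: Let a > b ≥ 1 be coprime integers and α_b,…,α_a integers with |α_b| = 1. If n, m, N are positive integers with gcd(n,N) = 1 and m^a = Σ_{j=b}^a α_j n^j N^{a−j}, then n is a perfect a-th power: n = z^a for some positive integer z (and then gcd(z,N) = 1). -/
theorem pow_aux (a b n d : ℕ) (hn : 0 < n) (hcop : Nat.Coprime a b)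
    (h : n ^ b = d ^ a) : ∃ z : ℕ, n = z ^ a := by
  have key : ∀ p, a ∣ n.factorization p := by
    intro p
    have h1 := congrArg (fun x => x.factorization p) h
    simp [Nat.factorization_pow] at h1
    exact hcop.dvd_of_dvd_mul_left ⟨_, h1⟩
  refine ⟨∏ p ∈ n.primeFactors, p ^ (n.factorization p / a), ?_⟩
  rw [← Finset.prod_pow]
  conv_lhs => rw [← Nat.prod_factorization_pow_eq_self hn.ne']
  rw [Finsupp.prod, Nat.support_factorization]
  refine Finset.prod_congr rfl fun p _ => ?_
  rw [← pow_mul, Nat.div_mul_cancel (key p)]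

/-- Structure of solutions with coprime parameter: if `gcd(n,N) = 1` and
`m^a = Σ_{j=b}^a α_j n^j N^{a−j}` with `a > b ≥ 1` coprime and `|α_b| = 1`,
then `n` is a perfect `a`-th power `n = z^a` with `gcd(z,N) = 1`. -/
theorem solution_is_ath_power
    (a b : ℕ) (hb : 1 ≤ b) (hba : b < a) (hcop : Nat.Coprime a b)
    (α : ℕ → ℤ) (hαb : |α b| = 1)
    (n m N : ℕ) (hn : 0 < n) (hm : 0 < m) (hN : 0 < N)
    (hgcd : Nat.gcd n N = 1)
    (heq : (m : ℤ) ^ a = ∑ j ∈ Finset.Icc b a, α j * (n : ℤ) ^ j * (N : ℤ) ^ (a - j)) :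
    ∃ z : ℕ, 0 < z ∧ n = z ^ a ∧ Nat.gcd z N = 1 := by
  have h0 : (n : ℤ) ^ (b + 1) ∣ ∑ j ∈ Finset.Ioc b a, α j * (n : ℤ) ^ j * (N : ℤ) ^ (a - j) := by
    refine Finset.dvd_sum fun j hj => ?_
    rw [Finset.mem_Ioc] at hj
    exact ((pow_dvd_pow _ hj.1).mul_left _).mul_right _
  obtain ⟨T, hT⟩ := h0
  rw [← Finset.add_sum_Ioc_eq_sum_Icc hba.le, hT] at heq
  have hQ : (m : ℤ) ^ a = (n : ℤ) ^ b * (α b * (N : ℤ) ^ (a - b) + n * T) := by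
    rw [heq]; ring
  have hnN : IsCoprime (n : ℤ) (N : ℤ) := Nat.isCoprime_iff_coprime.2 hgcd
  have hu : IsUnit (α b) := Int.isUnit_iff_abs_eq.2 hαb
  have hc : IsCoprime (n : ℤ) (α b * (N : ℤ) ^ (a - b) + n * T) := by
    apply IsCoprime.add_mul_left_right
    exact (isCoprime_one_right.of_isCoprime_of_dvd_right (isUnit_iff_dvd_one.1 hu)).mul_right hnN.pow_right
  set Q := α b * (N : ℤ) ^ (a - b) + n * T
  have hc' : Nat.Coprime (n ^ b) Q.natAbs := by
    have := Int.isCoprime_iff_gcd_eq_one.1 hc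
    exact Nat.Coprime.pow_left b (by simpa [Int.gcd] using this)
  have hQ' : n ^ b * Q.natAbs = m ^ a := by
    have := congrArg Int.natAbs hQ
    simpa [Int.natAbs_mul, Int.natAbs_pow] using this.symm
  obtain ⟨d, hd⟩ := exists_eq_pow_of_mul_eq_pow (by
    rw [Nat.isUnit_iff]; exact hc') hQ'
  obtain ⟨z, hz⟩ := pow_aux a b n d hn hcop hd
  refine ⟨z, ?_, hz, ?_⟩
  · rcases Nat.eq_zero_or_pos z with h | h
    · subst h; rw [zero_pow (by omega)] at hz; omega
    · exact h
  · refine Nat.Coprime.coprime_dvd_left ?_ hgcd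
    rw [hz]; exact dvd_pow_self z (by omega)
end

section
/- Lower bound for polynomial differences with a common large factor: Suppose p(n,N) = H(N)·P(n,N) + r(n,N) and q(m,N) = H(N)·Q(m,N) + s(m,N), where H is a nonconstant univariate polynomial, P and Q are bivariate polynomials with nonnegative integer coefficients, and r, s are bivariate polynomials with max(deg s, deg r) < deg H. Fix N and write Q_N(x) = Q(x,N), P_N(x) = P(x,N), and assume Q_N and P_N are nonconstant (hence strictly increasing on [0,∞)). Then for any integers 1 ≤ n, m ≤ N with P_N(n) > Q_N(0) and Q_N(m) > P_N(0), either Q_N(m) = P_N(n), or |q(m,N) − p(n,N)| ≥ Δ_N(n,m)·|H(N)| − |s(m,N) − r(n,N)|, where Δ_N(n,m) is the minimum of Q_N'(Q_N^{-1}(P_N(n)))/Q_N'(m) and P_N'(P_N^{-1}(Q_N(m)))/P_N'(n), and Q_N^{-1}, P_N^{-1} denote the inverse functions of Q_N, P_N restricted to [0,∞). -/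
noncomputable section

/-- Evaluation of a bivariate polynomial with natural coefficients
(outer variable `n`, inner variable `N`). -/
def bEval (Q : Polynomial (Polynomial ℕ)) (n N : ℕ) : ℕ :=
  (Q.map (Polynomial.evalRingHom N)).eval n

/-- Evaluation of a bivariate polynomial with integer coefficients. -/
def bEvalZ (Q : Polynomial (Polynomial ℤ)) (n N : ℕ) : ℤ :=
  (Q.map (Polynomial.evalRingHom (N : ℤ))).eval (n : ℤ)

/-- The degree of a bivariate polynomial `q(x,y)`, defined as the degree of `q(x,x)`. -/
def diagDegZ (Q : Polynomial (Polynomial ℤ)) : ℕ :=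
  (Q.eval Polynomial.X).natDegree

/-- For a fixed `N`, the real univariate polynomial `x ↦ Q(x,N)`. -/
def bPolyR (Q : Polynomial (Polynomial ℕ)) (N : ℕ) : Polynomial ℝ :=
  (Q.map (Polynomial.evalRingHom N)).map (Nat.castRingHom ℝ)

lemma natPoly_mono (A : Polynomial ℕ) {x y : ℝ} (hx : 0 ≤ x) (hxy : x ≤ y) :
    (A.map (Nat.castRingHom ℝ)).eval x ≤ (A.map (Nat.castRingHom ℝ)).eval y := by
  rw [Polynomial.eval_map, Polynomial.eval_map, Polynomial.eval₂_eq_sum_range,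
    Polynomial.eval₂_eq_sum_range]
  refine Finset.sum_le_sum fun i _ => ?_
  have h : (0 : ℝ) ≤ Nat.castRingHom ℝ (A.coeff i) := by simp
  exact mul_le_mul_of_nonneg_left (pow_le_pow_left₀ hx hxy i) h

lemma natPoly_nonneg (A : Polynomial ℕ) {x : ℝ} (hx : 0 ≤ x) :
    0 ≤ (A.map (Nat.castRingHom ℝ)).eval x := by
  rw [Polynomial.eval_map, Polynomial.eval₂_eq_sum_range]
  refine Finset.sum_nonneg fun i _ => ?_
  have h : (0 : ℝ) ≤ Nat.castRingHom ℝ (A.coeff i) := by simp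
  exact mul_nonneg h (pow_nonneg hx i)

lemma bPolyR_eval_nat (Q : Polynomial (Polynomial ℕ)) (N m : ℕ) :
    (bPolyR Q N).eval (m : ℝ) = (bEval Q m N : ℝ) := by
  unfold bPolyR bEval
  exact Polynomial.eval_natCast_map (Nat.castRingHom ℝ) _ m

lemma ratio_le_one (Q : Polynomial (Polynomial ℕ)) (N m : ℕ) (t : ℝ) (ht : 0 ≤ t)
    (h : (bPolyR Q N).eval t < (bPolyR Q N).eval (m : ℝ)) :
    (bPolyR Q N).derivative.eval t / (bPolyR Q N).derivative.eval (m : ℝ) ≤ 1 := by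
  have htm : t ≤ m := by
    by_contra hc
    exact absurd (natPoly_mono _ (Nat.cast_nonneg m) (not_le.mp hc).le) (not_le.mpr h)
  unfold bPolyR
  rw [Polynomial.derivative_map]
  exact div_le_one_of_le₀ (natPoly_mono _ ht htm) (natPoly_nonneg _ (Nat.cast_nonneg m))

/-- Lower bound for polynomial differences with a common large factor
(Proposition 3.1 of the paper).  Here `t = Q_N^{-1}(P_N(n))` and
`u = P_N^{-1}(Q_N(m))` are the (unique) nonnegative reals with
`Q_N(t) = P_N(n)` and `P_N(u) = Q_N(m)`. -/
theorem common_factor_difference_lower_bound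
    (H : Polynomial ℤ) (hH : 0 < H.natDegree)
    (P Q : Polynomial (Polynomial ℕ)) (r s : Polynomial (Polynomial ℤ))
    (hr : diagDegZ r < H.natDegree) (hs : diagDegZ s < H.natDegree)
    (p q : ℕ → ℕ → ℤ)
    (hp : ∀ n N : ℕ, p n N = H.eval (N : ℤ) * (bEval P n N : ℤ) + bEvalZ r n N)
    (hq : ∀ m N : ℕ, q m N = H.eval (N : ℤ) * (bEval Q m N : ℤ) + bEvalZ s m N)
    (N : ℕ)
    (hQN : 0 < (Q.map (Polynomial.evalRingHom N)).natDegree)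
    (hPN : 0 < (P.map (Polynomial.evalRingHom N)).natDegree)
    (n m : ℕ) (hn1 : 1 ≤ n) (hnN : n ≤ N) (hm1 : 1 ≤ m) (hmN : m ≤ N)
    (hPn : bEval Q 0 N < bEval P n N) (hQm : bEval P 0 N < bEval Q m N)
    (t u : ℝ) (ht : 0 ≤ t) (hu : 0 ≤ u)
    (htq : (bPolyR Q N).eval t = (bPolyR P N).eval (n : ℝ))
    (hup : (bPolyR P N).eval u = (bPolyR Q N).eval (m : ℝ)) :
    bEval Q m N = bEval P n N ∨
      min ((bPolyR Q N).derivative.eval t / (bPolyR Q N).derivative.eval (m : ℝ))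
          ((bPolyR P N).derivative.eval u / (bPolyR P N).derivative.eval (n : ℝ))
        * |(((H.eval (N : ℤ) : ℤ)) : ℝ)| - |(bEvalZ s m N : ℝ) - (bEvalZ r n N : ℝ)|
      ≤ |(q m N : ℝ) - (p n N : ℝ)| := by
  by_cases hne : bEval Q m N = bEval P n N
  · exact Or.inl hne
  right
  have hmin : min ((bPolyR Q N).derivative.eval t / (bPolyR Q N).derivative.eval (m : ℝ))
      ((bPolyR P N).derivative.eval u / (bPolyR P N).derivative.eval (n : ℝ)) ≤ 1 := by
    rcases lt_or_gt_of_ne hne with h | h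
    · refine (min_le_right _ _).trans (ratio_le_one P N n u hu ?_)
      rw [hup, bPolyR_eval_nat, bPolyR_eval_nat]
      exact_mod_cast h
    · refine (min_le_left _ _).trans (ratio_le_one Q N m t ht ?_)
      rw [htq, bPolyR_eval_nat, bPolyR_eval_nat]
      exact_mod_cast h
  have hdiff : (1 : ℝ) ≤ |(bEval Q m N : ℝ) - (bEval P n N : ℝ)| := by
    have h : (1 : ℤ) ≤ |(bEval Q m N : ℤ) - (bEval P n N : ℤ)| :=
      Int.one_le_abs (sub_ne_zero.mpr (by exact_mod_cast hne))
    exact_mod_cast h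
  have h1 := mul_le_mul_of_nonneg_right (hmin.trans hdiff)
    (abs_nonneg (((H.eval (N : ℤ) : ℤ)) : ℝ))
  rw [← abs_mul] at h1
  rw [hq, hp]
  push_cast
  have h2 := abs_sub_abs_le_abs_sub
    (((bEval Q m N : ℝ) - (bEval P n N : ℝ)) * (((H.eval (N : ℤ) : ℤ)) : ℝ))
    (-((bEvalZ s m N : ℝ) - (bEvalZ r n N : ℝ)))
  rw [abs_neg] at h2
  refine (sub_le_sub_right h1 _).trans (h2.trans (le_of_eq ?_))
  congr 1
  ring
end
end

section
/- Separation of integer points from polynomial preimages: Let Q be a nonconstant polynomial with nonnegative integer coefficients, let m be a positive integer, and let t ∈ [0, m] be a real number with Q(t) ∈ ℤ and Q(t) ≠ Q(m). Then |m − t| ≥ 1/Q'(m). -/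
/-- Separation of integer points from polynomial preimages: if `Q` is a nonconstant
polynomial with nonnegative integer coefficients, `m` a positive integer and
`t ∈ [0,m]` with `Q(t) ∈ ℤ` and `Q(t) ≠ Q(m)`, then `|m − t| ≥ 1/Q'(m)`. -/
theorem integer_point_separation
    (Q : Polynomial ℤ) (hcoeff : ∀ i, 0 ≤ Q.coeff i) (hdeg : 0 < Q.natDegree)
    (m : ℕ) (hm : 0 < m) (t : ℝ) (ht0 : 0 ≤ t) (htm : t ≤ (m : ℝ))
    (hint : ∃ z : ℤ, (Polynomial.aeval t) Q = (z : ℝ))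
    (hne : (Polynomial.aeval t) Q ≠ (Polynomial.aeval (m : ℝ)) Q) :
    1 / ((Polynomial.aeval (m : ℝ)) (Polynomial.derivative Q)) ≤ |(m : ℝ) - t| := by
  obtain ⟨z, hz⟩ := hint
  have hc : ∀ i, (0 : ℝ) ≤ ((Polynomial.derivative Q).coeff i : ℝ) := by
    intro i
    rw [Polynomial.coeff_derivative]
    have h := hcoeff (i + 1)
    have : (0 : ℤ) ≤ Q.coeff (i + 1) * ((i : ℤ) + 1) := by positivity
    exact_mod_cast this
  have hbound : ∀ x ∈ Set.Icc (0 : ℝ) m, ‖(Polynomial.aeval x) (Polynomial.derivative Q)‖ ≤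
      (Polynomial.aeval (m : ℝ)) (Polynomial.derivative Q) := by
    intro x hx
    rw [Polynomial.aeval_eq_sum_range, Polynomial.aeval_eq_sum_range]
    simp only [zsmul_eq_mul]
    have hx0 := hx.1
    rw [Real.norm_of_nonneg
      (Finset.sum_nonneg fun i _ => mul_nonneg (hc i) (pow_nonneg hx0 i))]
    exact Finset.sum_le_sum fun i _ =>
      mul_le_mul_of_nonneg_left (pow_le_pow_left₀ hx0 hx.2 i) (hc i)
  have hmv := (convex_Icc (0 : ℝ) m).norm_image_sub_le_of_norm_hasDerivWithin_le
    (f := fun x => (Polynomial.aeval x) Q)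
    (fun x _ => (Q.hasDerivAt_aeval x).hasDerivWithinAt) hbound
    (⟨ht0, htm⟩ : t ∈ Set.Icc (0 : ℝ) m) (⟨by positivity, le_rfl⟩ : (m : ℝ) ∈ Set.Icc (0 : ℝ) m)
  have hQm : (Polynomial.aeval (m : ℝ)) Q = ((Q.eval (m : ℤ) : ℤ) : ℝ) := by
    have := Polynomial.aeval_algebraMap_apply_eq_algebraMap_eval (A := ℝ) (m : ℤ) Q
    simpa using this
  have h1 : (1 : ℝ) ≤ ‖(Polynomial.aeval (m : ℝ)) Q - (Polynomial.aeval t) Q‖ := by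
    rw [hz, hQm] at hne ⊢
    have h2 : Q.eval (m : ℤ) - z ≠ 0 := by
      intro h
      apply hne
      rw [sub_eq_zero.mp h]
    rw [Real.norm_eq_abs]
    exact_mod_cast Int.one_le_abs h2
  have h3 := h1.trans hmv
  rw [Real.norm_eq_abs] at h3
  have hD : 0 < (Polynomial.aeval (m : ℝ)) (Polynomial.derivative Q) := by
    by_contra h
    have := mul_nonpos_of_nonpos_of_nonneg (not_lt.mp h) (abs_nonneg ((m : ℝ) - t))
    linarith
  rw [div_le_iff₀ hD]
  linarith
end

section
/- Two-sided bound on the leading correction term: In the homogeneous decomposition setup, suppose not all of the functions C_u (2 ≤ u ≤ k−1) are identically zero on [0,1], and let s_0 ≤ k−1 be the least index u with C_u not identically zero. Then for every δ ∈ (0,1) there exist positive constants B_1(δ), B_2(δ) and sets Γ_{N,δ} ⊆ [1,N] of cardinality at most δ·N, such that for all sufficiently large N and all integers n ∈ [δN, N] \ Γ_{N,δ}: B_1(δ)·N^{−(s_0−1)} ≤ |Σ_{u=s_0}^{k−1} N^{−(u−1)} C_u(n/N)| ≤ B_2(δ)·N^{−(s_0−1)}. -/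
noncomputable section

/-- The degree of a bivariate polynomial `q(x,y)`, defined as the degree of `q(x,x)`. -/
def diagDeg (Q : Polynomial (Polynomial ℕ)) : ℕ :=
  (Q.eval Polynomial.X).natDegree

/-- The homogeneous component `Q_u` of a bivariate polynomial:
`q(n,N) = Σ_u N^u Q_u(n/N)` with `deg Q_u ≤ u`. -/
def homComp (Q : Polynomial (Polynomial ℕ)) (u : ℕ) : Polynomial ℝ :=
  ∑ s ∈ Finset.range (u + 1),
    Polynomial.C (((Q.coeff s).coeff (u - s) : ℝ)) * Polynomial.X ^ s

/-- Two bivariate polynomials (given by their evaluations) have *exploding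
differences*. -/
def ExplodingDiff (q p : ℕ → ℕ → ℕ) : Prop :=
  ∀ δ : ℝ, 0 < δ → δ < 1 →
    ∃ C : ℝ, 0 < C ∧ ∃ N₀ : ℕ, ∃ Γ : ℕ → Finset ℕ,
      (∀ N : ℕ, ((Γ N).card : ℝ) ≤ δ * N) ∧ (∀ N : ℕ, ↑(Γ N) ⊆ Set.Icc 1 N) ∧
      ∀ N : ℕ, N₀ < N → ∀ n : ℕ, δ * N ≤ (n : ℝ) → n ≤ N → n ∉ Γ N →
        ∀ m : ℕ, δ * N ≤ (m : ℝ) → m ≤ N →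
          C * N ≤ |(q m N : ℝ) - (p n N : ℝ)|

section Helpers
open Set Filter Topology

lemma poly_pos (p : Polynomial ℝ) (hp : ∀ i, 0 ≤ p.coeff i) (h0 : p ≠ 0) (x : ℝ) (hx : 0 < x) :
    0 < p.eval x := by
  rw [Polynomial.eval_eq_sum_range]
  apply Finset.sum_pos'
  · intro i _
    exact mul_nonneg (hp i) (pow_nonneg hx.le i)
  · refine ⟨p.natDegree, by simp, mul_pos ?_ (pow_pos hx _)⟩
    exact lt_of_le_of_ne (hp _) (Ne.symm (by simpa using h0))

lemma poly_deriv_pos (p : Polynomial ℝ) (hp : ∀ i, 0 ≤ p.coeff i) (h0 : p.natDegree ≠ 0)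
    (x : ℝ) (hx : 0 < x) : 0 < p.derivative.eval x := by
  apply poly_pos _ _ _ x hx
  · intro i
    rw [Polynomial.coeff_derivative]
    exact mul_nonneg (hp _) (by positivity)
  · intro h
    exact h0 (Polynomial.derivative_eq_zero.1 h)

lemma poly_strictMono (p : Polynomial ℝ) (hp : ∀ i, 0 ≤ p.coeff i) (h0 : p.natDegree ≠ 0) :
    StrictMonoOn (fun x => p.eval x) (Ici 0) := by
  apply strictMonoOn_of_deriv_pos (convex_Ici 0) p.continuous.continuousOn
  intro x hx
  rw [interior_Ici] at hx
  rw [Polynomial.deriv]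
  exact poly_deriv_pos p hp h0 x hx

lemma poly_comp_analytic (A : Polynomial ℝ) (f : ℝ → ℝ) (y : ℝ) (hf : AnalyticAt ℝ f y) :
    AnalyticAt ℝ (fun z => A.eval (f z)) y := by
  have := AnalyticAt.aeval_polynomial hf A
  simpa [Polynomial.aeval_def, Polynomial.eval₂_eq_eval_map] using this

lemma gamma_analytic (p : Polynomial ℝ) (Q : Polynomial ℝ) (hQ : ∀ i, 0 ≤ Q.coeff i)
    (hQd : Q.natDegree ≠ 0) (γ : ℝ → ℝ) (hγ0 : ∀ y, 0 ≤ y → 0 ≤ γ y)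
    (hγ : ∀ y, 0 ≤ y → Q.eval (γ y) = p.eval y) (y : ℝ) (hy : 0 < y) (hpos : 0 < γ y) :
    AnalyticAt ℝ γ y := by
  have hd := poly_deriv_pos Q hQ hQd _ hpos
  have hcd : AnalyticAt ℝ (fun x => Q.eval x) (γ y) := poly_comp_analytic Q id _ analyticAt_id
  have hd' : deriv (fun x => Q.eval x) (γ y) ≠ 0 := by
    rw [Polynomial.deriv]; exact hd.ne'
  set g := hcd.hasStrictDerivAt.localInverse _ _ _ hd' with hg
  have h1 : AnalyticAt ℝ g (Q.eval (γ y)) := hcd.analyticAt_localInverse hd'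
  have h2 : g (Q.eval (γ y)) = γ y := HasStrictFDerivAt.localInverse_apply_image ..
  have h3 : ∀ᶠ z in 𝓝 (Q.eval (γ y)), Q.eval (g z) = z :=
    HasStrictDerivAt.eventually_right_inverse hcd.hasStrictDerivAt hd'
  rw [hγ y hy.le] at h1 h2 h3
  have hpc : ContinuousAt (fun x => p.eval x) y := p.continuous.continuousAt
  have hcomp : AnalyticAt ℝ (fun z => g (p.eval z)) y :=
    AnalyticAt.comp' h1 (poly_comp_analytic p id _ analyticAt_id)
  have h4 : ∀ᶠ z in 𝓝 y, Q.eval (g (p.eval z)) = p.eval z := hpc.eventually h3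
  have h5 : ∀ᶠ z in 𝓝 y, 0 < g (p.eval z) := by
    apply hcomp.continuousAt.eventually (lt_mem_nhds _)
    simp only [h2]; exact hpos
  have h6 : (fun z => g (p.eval z)) =ᶠ[𝓝 y] γ := by
    filter_upwards [h4, h5, lt_mem_nhds hy] with z hz4 hz5 hz
    apply (poly_strictMono Q hQ hQd).injOn (mem_Ici.2 hz5.le) (mem_Ici.2 (hγ0 z hz.le))
    simp only []
    rw [hz4, hγ z hz.le]
  exact hcomp.congr h6

lemma gamma_cont_zero (p : Polynomial ℝ) (Q : Polynomial ℝ) (hQ : ∀ i, 0 ≤ Q.coeff i)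
    (hQd : Q.natDegree ≠ 0) (hp : ∀ i, 0 ≤ p.coeff i)
    (hpd : p.natDegree ≠ 0) (γ : ℝ → ℝ) (hγ0 : ∀ y, 0 ≤ y → 0 ≤ γ y)
    (hγ : ∀ y, 0 ≤ y → Q.eval (γ y) = p.eval y) : ContinuousWithinAt γ (Ici 0) 0 := by
  have hm := poly_strictMono Q hQ hQd
  have hmp := poly_strictMono p hp hpd
  rw [ContinuousWithinAt, tendsto_order]
  constructor
  · intro a ha
    filter_upwards [self_mem_nhdsWithin] with y hy
    apply ha.trans_le
    rw [← hm.le_iff_le (hγ0 0 le_rfl) (hγ0 y hy)]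
    simp only [hγ 0 le_rfl, hγ y hy]
    exact hmp.monotoneOn (mem_Ici.2 le_rfl) hy hy
  · intro a ha
    have ha0 : 0 ≤ a := (hγ0 0 le_rfl).trans ha.le
    have h1 : p.eval 0 < Q.eval a := by
      rw [← hγ 0 le_rfl]; exact hm (hγ0 0 le_rfl) ha0 ha
    have h2 : ∀ᶠ y in 𝓝 (0:ℝ), p.eval y < Q.eval a :=
      p.continuous.continuousAt.eventually (gt_mem_nhds h1)
    filter_upwards [self_mem_nhdsWithin, mem_nhdsWithin_of_mem_nhds h2] with y hy hy2
    rw [← hm.lt_iff_lt (hγ0 y hy) ha0]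
    simp only [hγ y hy]
    exact hy2

lemma finite_zeros (F : ℝ → ℝ) (hF : AnalyticOnNhd ℝ F (Ioi 0)) (hne : ∃ y, 0 < y ∧ F y ≠ 0)
    (δ : ℝ) (hδ : 0 < δ) : {y ∈ Icc δ 1 | F y = 0}.Finite := by
  by_contra hinf
  obtain ⟨z, hz, hacc⟩ := Set.Infinite.exists_accPt_of_subset_isCompact hinf
    (isCompact_Icc (a := δ) (b := 1)) (fun y hy => hy.1)
  obtain ⟨y, hy, hFy⟩ := hne
  apply hFy
  refine hF.eqOn_zero_of_preconnected_of_frequently_eq_zero isPreconnected_Ioi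
    (mem_Ioi.2 (hδ.trans_le hz.1)) ?_ (mem_Ioi.2 hy)
  rw [accPt_iff_frequently_nhdsNE] at hacc
  exact hacc.mono fun y hy => hy.2

lemma count_near (N : ℕ) (z r : ℝ) (hr : 0 ≤ r) :
    ((((Finset.Icc 1 N).filter (fun n : ℕ => |(n:ℝ) - z| < r)).card : ℕ) : ℝ) ≤ 2 * r + 1 := by
  have h1 : ((Finset.Icc 1 N).filter (fun n : ℕ => |(n:ℝ) - z| < r)).card ≤
      (Finset.Icc ⌈z - r⌉ ⌊z + r⌋).card := by
    apply Finset.card_le_card_of_injOn (fun n : ℕ => (n:ℤ))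
    · intro n hn
      simp only [Finset.coe_filter, mem_ofPred_eq, abs_lt] at hn
      simp only [Finset.coe_Icc, mem_Icc, Int.ceil_le, Int.le_floor, Int.cast_natCast]
      constructor <;> linarith [hn.2.1, hn.2.2]
    · exact fun a _ b _ h => by simpa using h
  rw [Int.card_Icc] at h1
  have h2 : ((⌊z + r⌋ + 1 - ⌈z - r⌉).toNat : ℝ) ≤ 2 * r + 1 := by
    have : (((⌊z + r⌋ + 1 - ⌈z - r⌉).toNat : ℤ) : ℝ) ≤ 2 * r + 1 := by
      rw [Int.toNat_eq_max]
      push_cast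
      apply max_le _ (by linarith)
      linarith [Int.floor_le (z+r), Int.le_ceil (z-r)]
    exact_mod_cast this
  exact le_trans (by exact_mod_cast h1) h2

lemma abstract_bound (C : ℕ → ℝ → ℝ) (δ : ℝ) (hδ : 0 < δ) (hδ1 : δ < 1) (s₀ K : ℕ) (hs : s₀ ≤ K)
    (hcont : ∀ u, ContinuousOn (C u) (Icc δ 1)) (hfin : {y ∈ Icc δ 1 | C s₀ y = 0}.Finite) :
      ∃ B₁ B₂ : ℝ, 0 < B₁ ∧ 0 < B₂ ∧ ∃ Γ : ℕ → Finset ℕ,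
        (∀ N : ℕ, ((Γ N).card : ℝ) ≤ δ * N) ∧ (∀ N : ℕ, ↑(Γ N) ⊆ Set.Icc 1 N) ∧
        ∃ N₀ : ℕ, ∀ N : ℕ, N₀ ≤ N → ∀ n : ℕ, δ * N ≤ (n : ℝ) → n ≤ N → n ∉ Γ N →
          B₁ * (N : ℝ) ^ (-((s₀ : ℝ) - 1)) ≤
            |∑ u ∈ Finset.Icc s₀ K, (N : ℝ) ^ (-((u : ℝ) - 1)) * C u ((n:ℝ)/N)| ∧
          |∑ u ∈ Finset.Icc s₀ K, (N : ℝ) ^ (-((u : ℝ) - 1)) * C u ((n:ℝ)/N)|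
            ≤ B₂ * (N : ℝ) ^ (-((s₀ : ℝ) - 1)) := by
  classical
  set Z := hfin.toFinset with hZ
  set M : ℝ := (Z.card : ℝ) with hM
  have hM0 : 0 ≤ M := by positivity
  set η : ℝ := δ / (4 * (M + 1)) with hη
  have hη0 : 0 < η := by positivity
  have hMη : M * (2 * η) ≤ δ / 2 := by
    rw [hη]
    have : M * (2 * (δ / (4 * (M + 1)))) = (δ / 2) * (M / (M+1)) := by field_simp; ring
    rw [this]
    have : M / (M+1) ≤ 1 := by rw [div_le_one (by positivity)]; linarith
    nlinarith
  -- upper bound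
  have hD : ∃ D : ℝ, 0 < D ∧ ∀ u ∈ Finset.Icc s₀ K, ∀ y ∈ Icc δ 1, |C u y| ≤ D := by
    have : ∀ u, ∃ D : ℝ, ∀ y ∈ Icc δ 1, ‖C u y‖ ≤ D := fun u =>
      isCompact_Icc.exists_bound_of_continuousOn (hcont u)
    choose D hD using this
    refine ⟨1 + ∑ u ∈ Finset.Icc s₀ K, |D u|, by positivity, fun u hu y hy => ?_⟩
    have h1 := hD u y hy
    have h2 := Finset.single_le_sum (f := fun u => |D u|) (fun i _ => abs_nonneg _) hu
    rw [Real.norm_eq_abs] at h1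
    linarith [le_abs_self (D u)]
  obtain ⟨D, hD0, hD⟩ := hD
  -- lower bound
  have hc : ∃ c : ℝ, 0 < c ∧ ∀ y ∈ Icc δ 1, (∀ z ∈ Z, η ≤ |y - z|) → c ≤ |C s₀ y| := by
    set S : Set ℝ := Icc δ 1 ∩ ⋂ z ∈ Z, {y | η ≤ |y - z|} with hS
    have hSc : IsCompact S := by
      apply isCompact_Icc.inter_right
      apply isClosed_biInter
      intro z _
      exact isClosed_le continuous_const (by fun_prop)
    rcases S.eq_empty_or_nonempty with he | hne
    · refine ⟨1, one_pos, fun y hy hz => ?_⟩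
      have : y ∈ S := ⟨hy, by simpa using hz⟩
      rw [he] at this
      exact this.elim
    · obtain ⟨x, hx, hmin⟩ := hSc.exists_isMinOn hne
        (((hcont s₀).mono (fun y hy => hy.1)).abs)
      refine ⟨|C s₀ x|, ?_, fun y hy hz => hmin (show y ∈ S from ⟨hy, by simpa using hz⟩)⟩
      rw [abs_pos]
      intro h0
      have hxZ : x ∈ Z := by rw [hZ, Set.Finite.mem_toFinset]; exact ⟨hx.1, h0⟩
      have := hx.2
      simp only [mem_iInter, mem_ofPred_eq] at this
      have := this x hxZ
      simp at this
      linarith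
  obtain ⟨c, hc0, hc⟩ := hc
  set L : ℝ := ((Finset.Icc s₀ K).card : ℝ) with hL
  have hL0 : 0 < L := by
    rw [hL]; simp; omega
  obtain ⟨N₁, hN₁⟩ := exists_nat_ge (2 * M / δ)
  obtain ⟨N₂, hN₂⟩ := exists_nat_ge (2 * L * D / c)
  refine ⟨c / 2, L * D, by positivity, by positivity,
    fun N => if N₁ ≤ N then (Finset.Icc 1 N).filter
      (fun n : ℕ => ∃ z ∈ Z, |(n:ℝ) - z * N| < η * N) else ∅, ?_, ?_, N₁ + N₂ + 1, ?_⟩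
  · intro N
    simp only
    split_ifs with hN
    · have h1 : ((Finset.Icc 1 N).filter
        (fun n : ℕ => ∃ z ∈ Z, |(n:ℝ) - z * N| < η * N)) ⊆
        Z.biUnion (fun z => (Finset.Icc 1 N).filter (fun n : ℕ => |(n:ℝ) - z * N| < η * N)) := by
        intro n hn
        simp only [Finset.mem_filter, Finset.mem_biUnion] at hn ⊢
        obtain ⟨h, z, hz, hh⟩ := hn
        exact ⟨z, hz, h, hh⟩
      have h2 := (Finset.card_le_card h1).trans Finset.card_biUnion_le
      have h3 : (((Finset.Icc 1 N).filter
        (fun n : ℕ => ∃ z ∈ Z, |(n:ℝ) - z * N| < η * N)).card : ℝ) ≤ ∑ z ∈ Z, (2 * (η * N) + 1) := by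
        refine le_trans (Nat.cast_le.2 h2) ?_
        push_cast
        exact Finset.sum_le_sum fun z _ => count_near N (z * N) (η * N) (by positivity)
      rw [Finset.sum_const, nsmul_eq_mul] at h3
      have h4 : 2 * M / δ ≤ N := hN₁.trans (by exact_mod_cast hN)
      rw [div_le_iff₀ hδ] at h4
      have h5 := mul_le_mul_of_nonneg_right hMη (Nat.cast_nonneg (α := ℝ) N)
      rw [← hM] at h3
      nlinarith
    · simp; positivity
  · intro N
    simp only
    split_ifs with hN
    · intro n hn
      simp only [Finset.coe_filter, mem_ofPred_eq, Finset.mem_Icc] at hn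
      exact hn.1
    · simp
  · intro N hN n hn1 hn2 hnΓ
    simp only [if_pos (by omega : N₁ ≤ N)] at hnΓ
    have hN1 : (1:ℝ) ≤ N := by exact_mod_cast (by omega : 1 ≤ N)
    have hNp : (0:ℝ) < N := by linarith
    set y : ℝ := (n:ℝ) / N with hy
    have hyI : y ∈ Icc δ 1 := by
      constructor
      · rw [hy, le_div_iff₀ hNp]; exact hn1
      · rw [hy, div_le_one hNp]; exact_mod_cast hn2
    have hn0 : 1 ≤ n := by
      have : (0:ℝ) < n := lt_of_lt_of_le (by positivity) hn1
      exact_mod_cast this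
    have hyZ : ∀ z ∈ Z, η ≤ |y - z| := by
      intro z hz
      by_contra hlt
      push Not at hlt
      apply hnΓ
      simp only [Finset.mem_filter, Finset.mem_Icc]
      refine ⟨⟨hn0, hn2⟩, z, hz, ?_⟩
      have : (n:ℝ) - z * N = (y - z) * N := by rw [hy]; field_simp
      rw [this, abs_mul, abs_of_pos hNp]
      exact mul_lt_mul_of_pos_right hlt hNp
    have hcy := hc y hyI hyZ
    set W : ℝ := (N : ℝ) ^ (-((s₀ : ℝ) - 1)) with hW
    have hW0 : 0 < W := Real.rpow_pos_of_pos hNp _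
    constructor
    · have hmem : s₀ ∈ Finset.Icc s₀ K := by simp [hs]
      rw [← Finset.add_sum_erase _ _ hmem]
      have herr : |∑ u ∈ (Finset.Icc s₀ K).erase s₀, (N : ℝ) ^ (-((u : ℝ) - 1)) * C u y|
          ≤ (c / 2) * W := by
        have h1 : ∀ u ∈ (Finset.Icc s₀ K).erase s₀,
            |(N : ℝ) ^ (-((u : ℝ) - 1)) * C u y| ≤ (W / N) * D := by
          intro u hu
          rw [abs_mul, abs_of_pos (Real.rpow_pos_of_pos hNp _)]
          have hu' := Finset.mem_erase.1 hu
          have hlt : s₀ + 1 ≤ u := by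
            have := (Finset.mem_Icc.1 hu'.2).1
            have := hu'.1
            omega
          have hltR : (s₀:ℝ) + 1 ≤ u := by exact_mod_cast hlt
          apply mul_le_mul _ (hD u hu'.2 y hyI) (abs_nonneg _) (by positivity)
          rw [hW, ← Real.rpow_sub_one hNp.ne']
          exact Real.rpow_le_rpow_of_exponent_le hN1 (by linarith)
        calc _ ≤ ∑ u ∈ (Finset.Icc s₀ K).erase s₀, |(N : ℝ) ^ (-((u : ℝ) - 1)) * C u y| :=
              Finset.abs_sum_le_sum_abs _ _
          _ ≤ ∑ u ∈ (Finset.Icc s₀ K).erase s₀, (W / N) * D := Finset.sum_le_sum h1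
          _ ≤ ∑ u ∈ (Finset.Icc s₀ K), (W / N) * D :=
              Finset.sum_le_sum_of_subset_of_nonneg (Finset.erase_subset _ _)
                (fun _ _ _ => by positivity)
          _ = (L * D / N) * W := by rw [Finset.sum_const, nsmul_eq_mul, ← hL]; ring
          _ ≤ (c / 2) * W := by
              apply mul_le_mul_of_nonneg_right _ hW0.le
              have h4 : 2 * L * D / c ≤ N := hN₂.trans (by exact_mod_cast (by omega : N₂ ≤ N))
              rw [div_le_iff₀ hc0] at h4
              rw [div_le_iff₀ hNp]
              linarith
      have hmain : c * W ≤ |W * C s₀ y| := by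
        rw [abs_mul, abs_of_pos hW0]; nlinarith
      have := abs_sub_abs_le_abs_add (W * C s₀ y)
        (∑ u ∈ (Finset.Icc s₀ K).erase s₀, (N : ℝ) ^ (-((u : ℝ) - 1)) * C u y)
      linarith
    · calc _ ≤ ∑ u ∈ (Finset.Icc s₀ K), |(N : ℝ) ^ (-((u : ℝ) - 1)) * C u y| :=
              Finset.abs_sum_le_sum_abs _ _
          _ ≤ ∑ u ∈ (Finset.Icc s₀ K), W * D := by
            apply Finset.sum_le_sum
            intro u hu
            rw [abs_mul, abs_of_pos (Real.rpow_pos_of_pos hNp _)]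
            have hltR : (s₀:ℝ) ≤ u := by exact_mod_cast (Finset.mem_Icc.1 hu).1
            apply mul_le_mul _ (hD u hu y hyI) (abs_nonneg _) (by positivity)
            exact Real.rpow_le_rpow_of_exponent_le hN1 (by linarith)
          _ = L * D * W := by rw [Finset.sum_const, nsmul_eq_mul, ← hL]; ring

lemma main_abs (qc pc : ℕ → Polynomial ℝ) (hq : ∀ u i, 0 ≤ (qc u).coeff i)
    (hp : ∀ u i, 0 ≤ (pc u).coeff i) (k : ℕ) 
    (hQk : (qc k).natDegree ≠ 0) (hPk : (pc k).natDegree ≠ 0)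
    (h0 : (qc k).eval 0 ≤ (pc k).eval 0)
    (γ : ℝ → ℝ) (hγ0 : ∀ y : ℝ, 0 ≤ y → 0 ≤ γ y)
    (hγ : ∀ y : ℝ, 0 ≤ y → (qc k).eval (γ y) = (pc k).eval y)
    (s₀ : ℕ)
    (hCnz : ¬ ∀ y ∈ Set.Icc (0 : ℝ) 1,
      ((qc (k - s₀)).eval (γ y) - (pc (k - s₀)).eval y)
        / ((qc k).derivative.eval (γ y)) = 0) (δ : ℝ) (hδ : 0 < δ) :
    (∀ u, ContinuousOn (fun y => ((qc (k - u)).eval (γ y) - (pc (k - u)).eval y)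
        / ((qc k).derivative.eval (γ y))) (Icc δ 1)) ∧
    {y ∈ Icc δ 1 | ((qc (k - s₀)).eval (γ y) - (pc (k - s₀)).eval y)
        / ((qc k).derivative.eval (γ y)) = 0}.Finite := by
  have hpos : ∀ y, 0 < y → 0 < γ y := by
    intro y hy
    refine lt_of_le_of_ne (hγ0 y hy.le) fun h => ?_
    have h1 := hγ y hy.le
    rw [← h] at h1
    have h2 := poly_strictMono (pc k) (hp k) hPk (mem_Ici.2 le_rfl) (mem_Ici.2 hy.le) hy
    simp only at h2
    linarith
  have han : ∀ y, 0 < y → AnalyticAt ℝ γ y := fun y hy =>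
    gamma_analytic (pc k) (qc k) (hq k) hQk γ hγ0 hγ y hy (hpos y hy)
  have hCan : ∀ u, AnalyticOnNhd ℝ (fun y => ((qc (k - u)).eval (γ y) - (pc (k - u)).eval y)
        / ((qc k).derivative.eval (γ y))) (Ioi 0) := by
    intro u y hy
    refine AnalyticAt.div ((poly_comp_analytic _ _ _ (han y hy)).sub
      (poly_comp_analytic _ _ _ analyticAt_id)) (poly_comp_analytic _ _ _ (han y hy)) ?_
    exact (poly_deriv_pos _ (hq k) hQk _ (hpos y hy)).ne'
  refine ⟨fun u => (hCan u).continuousOn.mono fun y hy => mem_Ioi.2 (hδ.trans_le hy.1), ?_⟩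
  apply finite_zeros _ (hCan s₀) _ δ hδ
  push Not at hCnz
  obtain ⟨y, hy, hne⟩ := hCnz
  rcases hy.1.lt_or_eq with hlt | heq
  · exact ⟨y, hlt, hne⟩
  · subst heq
    have hgc := gamma_cont_zero (pc k) (qc k) (hq k) hQk (hp k) hPk γ hγ0 hγ
    have hden : ((qc k).derivative.eval (γ 0)) ≠ 0 := fun h => hne (by rw [h, div_zero])
    have hc : ContinuousWithinAt (fun y => ((qc (k - s₀)).eval (γ y) - (pc (k - s₀)).eval y)
        / ((qc k).derivative.eval (γ y))) (Ici 0) 0 := by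
      refine ContinuousWithinAt.div (ContinuousWithinAt.sub ?_ ?_) ?_ hden
      · exact (qc (k - s₀)).continuous.continuousAt.comp_continuousWithinAt hgc
      · exact (pc (k - s₀)).continuous.continuousWithinAt
      · exact (qc k).derivative.continuous.continuousAt.comp_continuousWithinAt hgc
    have h2 := (hc.mono (Ioi_subset_Ici_self)).eventually_ne hne
    obtain ⟨x, hx, hx0⟩ := (h2.and self_mem_nhdsWithin).exists
    exact ⟨x, hx0, hx⟩

end Helpers

lemma homComp_nonneg (Q : Polynomial (Polynomial ℕ)) (u i : ℕ) : 0 ≤ (homComp Q u).coeff i := by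
  unfold homComp
  rw [Polynomial.finset_sum_coeff]
  apply Finset.sum_nonneg
  intro s _
  rw [Polynomial.coeff_C_mul, Polynomial.coeff_X_pow]
  split_ifs <;> simp

/-- Two-sided bound on the leading correction term (Lemma 3.2 of the paper).
Here `C_u(y) = (Q_{k−u}(γ(y)) − P_{k−u}(y))/Q_k'(γ(y))`. -/
theorem leading_correction_two_sided_bound
    (qq pp : Polynomial (Polynomial ℕ)) (k : ℕ) (hk : 1 < k)
    (hdq : diagDeg qq = k) (hdp : diagDeg pp = k)
    (hqn : 0 < qq.natDegree) (hpn : 0 < pp.natDegree)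
    (hQk : (homComp qq k).natDegree ≠ 0) (hPk : (homComp pp k).natDegree ≠ 0)
    (h0 : (homComp qq k).eval 0 ≤ (homComp pp k).eval 0)
    -- γ = Q_k^{-1} ∘ P_k on [0,∞)
    (γ : ℝ → ℝ) (hγ0 : ∀ y : ℝ, 0 ≤ y → 0 ≤ γ y)
    (hγ : ∀ y : ℝ, 0 ≤ y → (homComp qq k).eval (γ y) = (homComp pp k).eval y)
    (s₀ : ℕ) (hs₀2 : 2 ≤ s₀) (hs₀k : s₀ ≤ k - 1)
    -- C_{s₀} is not identically zero on [0,1]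
    (hCnz : ¬ ∀ y ∈ Set.Icc (0 : ℝ) 1,
      ((homComp qq (k - s₀)).eval (γ y) - (homComp pp (k - s₀)).eval y)
        / ((homComp qq k).derivative.eval (γ y)) = 0)
    -- s₀ is the least such index
    (hCmin : ∀ u : ℕ, 2 ≤ u → u < s₀ → ∀ y ∈ Set.Icc (0 : ℝ) 1,
      ((homComp qq (k - u)).eval (γ y) - (homComp pp (k - u)).eval y)
        / ((homComp qq k).derivative.eval (γ y)) = 0) :
    ∀ δ : ℝ, 0 < δ → δ < 1 →
      ∃ B₁ B₂ : ℝ, 0 < B₁ ∧ 0 < B₂ ∧ ∃ Γ : ℕ → Finset ℕ,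
        (∀ N : ℕ, ((Γ N).card : ℝ) ≤ δ * N) ∧ (∀ N : ℕ, ↑(Γ N) ⊆ Set.Icc 1 N) ∧
        ∃ N₀ : ℕ, ∀ N : ℕ, N₀ ≤ N → ∀ n : ℕ, δ * N ≤ (n : ℝ) → n ≤ N → n ∉ Γ N →
          B₁ * (N : ℝ) ^ (-((s₀ : ℝ) - 1)) ≤
            |∑ u ∈ Finset.Icc s₀ (k - 1), (N : ℝ) ^ (-((u : ℝ) - 1)) *
              (((homComp qq (k - u)).eval (γ ((n : ℝ) / N))
                  - (homComp pp (k - u)).eval ((n : ℝ) / N))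
                / ((homComp qq k).derivative.eval (γ ((n : ℝ) / N))))| ∧
          |∑ u ∈ Finset.Icc s₀ (k - 1), (N : ℝ) ^ (-((u : ℝ) - 1)) *
              (((homComp qq (k - u)).eval (γ ((n : ℝ) / N))
                  - (homComp pp (k - u)).eval ((n : ℝ) / N))
                / ((homComp qq k).derivative.eval (γ ((n : ℝ) / N))))|
            ≤ B₂ * (N : ℝ) ^ (-((s₀ : ℝ) - 1)) := by
  intro δ hδ hδ1
  obtain ⟨hcont, hfin⟩ := main_abs (homComp qq) (homComp pp) (homComp_nonneg qq)
    (homComp_nonneg pp) k hQk hPk h0 γ hγ0 hγ s₀ hCnz δ hδ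
  exact abstract_bound (fun u y => ((homComp qq (k - u)).eval (γ y) - (homComp pp (k - u)).eval y)
        / ((homComp qq k).derivative.eval (γ y))) δ hδ hδ1 s₀ (k - 1) hs₀k hcont hfin
end
end

section
/- Taylor identity for bivariate polynomial differences: In the homogeneous decomposition setup, for all positive integers n, m, N, writing y = n/N, one has q(m,N) − p(n,N) = Σ_{u=0}^{k} N^{k−u} ( Σ_{s=0}^{u} (Q_{s+k−u}^{(s)}(γ_k(y))/s!)·(m − N·γ_k(y))^s − P_{k−u}(y) ), where Q_j^{(s)} denotes the s-th derivative of Q_j; in particular, since Q_k(γ_k(y)) = P_k(y), the u = 0 term vanishes and q(m,N) − p(n,N) = N^{k−1}·Q_k'(γ_k(y))·(m − N·γ_k(y) − R_k(y)) + Σ_{u=2}^{k} N^{k−u} ( Σ_{s=0}^{u} (Q_{s+k−u}^{(s)}(γ_k(y))/s!)·(m − N·γ_k(y))^s − P_{k−u}(y) ). -/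
noncomputable section

open Finset in
lemma aux_coeff_zero (Q : Polynomial (Polynomial ℕ)) (s t : ℕ) (h : diagDeg Q < s + t) :
    (Q.coeff s).coeff t = 0 := by
  have h1 : (Q.eval Polynomial.X).coeff (s + t) = 0 :=
    Polynomial.coeff_eq_zero_of_natDegree_lt h
  rw [Polynomial.eval_eq_sum, Polynomial.sum_def, Polynomial.finsetSum_coeff,
    Finset.sum_eq_zero_iff] at h1
  by_cases hs : s ∈ Q.support
  · have := h1 s hs
    rwa [add_comm, Polynomial.coeff_mul_X_pow] at this
  · rw [Polynomial.notMem_support_iff.mp hs]; simp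

lemma aux_bEval (Q : Polynomial (Polynomial ℕ)) (k : ℕ) (hd : diagDeg Q = k) (m N : ℕ) :
    (bEval Q m N : ℝ) = ∑ s ∈ Finset.range (k + 1), ∑ t ∈ Finset.range (k + 1 - s),
      ((Q.coeff s).coeff t : ℝ) * (N : ℝ) ^ t * (m : ℝ) ^ s := by
  have hz := aux_coeff_zero Q
  rw [hd] at hz
  have hQ : Q.natDegree < k + 1 := by
    rw [Nat.lt_succ_iff, Polynomial.natDegree_le_iff_coeff_eq_zero]
    intro s hs
    ext t
    rw [hz s t (by omega)]; simp
  have hQ2 : (Q.map (Polynomial.evalRingHom N)).natDegree < k + 1 :=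
    lt_of_le_of_lt Polynomial.natDegree_map_le hQ
  unfold bEval
  rw [Polynomial.eval_eq_sum_range' hQ2]
  push_cast
  refine Finset.sum_congr rfl fun s hs => ?_
  have hs' : s < k + 1 := Finset.mem_range.mp hs
  have hc : (Q.coeff s).natDegree < k + 1 - s := by
    have : (Q.coeff s).natDegree ≤ k - s := by
      rw [Polynomial.natDegree_le_iff_coeff_eq_zero]
      intro t ht
      exact hz s t (by omega)
    omega
  rw [Polynomial.coeff_map, Polynomial.coe_evalRingHom, Polynomial.eval_eq_sum_range' hc]
  push_cast
  rw [Finset.sum_mul]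

lemma aux_homog (Q : Polynomial (Polynomial ℕ)) (k : ℕ) (hd : diagDeg Q = k) (m N : ℕ)
    (hN : 0 < N) :
    (bEval Q m N : ℝ) = ∑ j ∈ Finset.range (k + 1),
      (N : ℝ) ^ j * (homComp Q j).eval ((m : ℝ) / N) := by
  have hN' : (N : ℝ) ≠ 0 := by positivity
  rw [aux_bEval Q k hd, ← Finset.sum_range_diag_flip]
  refine Finset.sum_congr rfl fun j _ => ?_
  unfold homComp
  rw [Polynomial.eval_finsetSum, Finset.mul_sum]
  refine Finset.sum_congr rfl fun s hs => ?_
  have hs' : s ≤ j := Nat.lt_succ_iff.mp (Finset.mem_range.mp hs)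
  obtain ⟨t, rfl⟩ := Nat.exists_eq_add_of_le hs'
  simp only [Polynomial.eval_mul, Polynomial.eval_C, Polynomial.eval_pow, Polynomial.eval_X,
    Nat.add_sub_cancel_left]
  rw [div_pow, pow_add]
  field_simp

lemma aux_homComp_coeff (Q : Polynomial (Polynomial ℕ)) (j i : ℕ) :
    0 ≤ (homComp Q j).coeff i := by
  unfold homComp
  rw [Polynomial.finsetSum_coeff]
  refine Finset.sum_nonneg fun s _ => ?_
  rw [Polynomial.coeff_C_mul, Polynomial.coeff_X_pow]
  split_ifs <;> simp

lemma aux_homComp_deg (Q : Polynomial (Polynomial ℕ)) (j : ℕ) :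
    (homComp Q j).natDegree ≤ j := by
  unfold homComp
  refine Polynomial.natDegree_sum_le_of_forall_le _ _ fun s hs => ?_
  exact (Polynomial.natDegree_C_mul_X_pow_le _ _).trans
    (Nat.lt_succ_iff.mp (Finset.mem_range.mp hs))

lemma aux_taylor (f : Polynomial ℝ) (j : ℕ) (hf : f.natDegree ≤ j) (g x : ℝ) :
    f.eval x = ∑ s ∈ Finset.range (j + 1),
      ((Polynomial.derivative^[s] f).eval g / (Nat.factorial s : ℝ)) * (x - g) ^ s := by
  have h : f.eval x = (Polynomial.taylor g f).eval (x - g) := by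
    rw [Polynomial.taylor_eval]; simp
  rw [h, Polynomial.eval_eq_sum_range' (n := j + 1)
    (by rw [Polynomial.natDegree_taylor]; omega)]
  refine Finset.sum_congr rfl fun s _ => ?_
  congr 1
  rw [Polynomial.taylor_coeff, eq_div_iff (by positivity), ← Polynomial.factorial_smul_hasseDeriv]
  simp [mul_comm]

lemma aux_pos (f : Polynomial ℝ) (hc : ∀ i, 0 ≤ f.coeff i) (hd : f.natDegree ≠ 0) (x : ℝ)
    (hx : 0 < x) : f.eval 0 < f.eval x ∧ 0 < f.derivative.eval x := by
  have hl : 0 < f.coeff f.natDegree := by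
    refine lt_of_le_of_ne (hc _) (Ne.symm ?_)
    intro h
    apply hd
    rw [Polynomial.coeff_natDegree, Polynomial.leadingCoeff_eq_zero] at h
    simp [h]
  constructor
  · rw [Polynomial.eval_eq_sum_range (p := f) x, Finset.sum_range_succ', ← Polynomial.coeff_zero_eq_eval_zero]
    simp only [pow_zero, mul_one]
    have : 0 < ∑ i ∈ Finset.range f.natDegree, f.coeff (i + 1) * x ^ (i + 1) := by
      refine Finset.sum_pos' (fun i _ => mul_nonneg (hc _) (by positivity))
        ⟨f.natDegree - 1, Finset.mem_range.mpr (by omega), ?_⟩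
      rw [Nat.sub_add_cancel (by omega)]
      positivity
    linarith
  · rw [Polynomial.derivative_eval, Polynomial.sum_def]
    refine Finset.sum_pos' (fun i _ => mul_nonneg (mul_nonneg (hc _) (by positivity)) (by positivity))
      ⟨f.natDegree, ?_, ?_⟩
    · exact Polynomial.mem_support_iff.mpr hl.ne'
    · have : (0 : ℝ) < f.natDegree := by exact_mod_cast Nat.pos_of_ne_zero hd
      positivity

lemma aux_flip (k : ℕ) (G : ℕ → ℕ → ℝ) :
    ∑ j ∈ Finset.range (k + 1), ∑ s ∈ Finset.range (j + 1), G s (j - s)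
      = ∑ u ∈ Finset.range (k + 1), ∑ s ∈ Finset.range (u + 1), G s (k - u) := by
  rw [Finset.sum_range_diag_flip,
    ← Finset.sum_range_reflect (fun u => ∑ s ∈ Finset.range (u + 1), G s (k - u))]
  rw [Finset.sum_comm' (t' := Finset.range (k + 1)) (s' := fun t => Finset.range (k + 1 - t))
    (by intro a b; simp only [Finset.mem_range]; omega)]
  refine Finset.sum_congr rfl fun t ht => ?_
  have ht' := Finset.mem_range.mp ht
  rw [show k + 1 - 1 - t + 1 = k + 1 - t by omega, show k - (k + 1 - 1 - t) = t by omega]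

/-- Taylor identity for bivariate polynomial differences (Lemma 3.3 of the paper). -/
theorem taylor_identity_bivariate_difference
    (qq pp : Polynomial (Polynomial ℕ)) (k : ℕ) (hk : 1 < k)
    (hdq : diagDeg qq = k) (hdp : diagDeg pp = k)
    (hqn : 0 < qq.natDegree) (hpn : 0 < pp.natDegree)
    (hQk : (homComp qq k).natDegree ≠ 0) (hPk : (homComp pp k).natDegree ≠ 0)
    (h0 : (homComp qq k).eval 0 ≤ (homComp pp k).eval 0)
    -- γ = Q_k^{-1} ∘ P_k on [0,∞)
    (γ : ℝ → ℝ) (hγ0 : ∀ y : ℝ, 0 ≤ y → 0 ≤ γ y)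
    (hγ : ∀ y : ℝ, 0 ≤ y → (homComp qq k).eval (γ y) = (homComp pp k).eval y)
    (n m N : ℕ) (hn : 0 < n) (hm : 0 < m) (hN : 0 < N) :
    ((bEval qq m N : ℝ) - (bEval pp n N : ℝ) =
      ∑ u ∈ Finset.range (k + 1), (N : ℝ) ^ (k - u) *
        ((∑ s ∈ Finset.range (u + 1),
            ((Polynomial.derivative^[s] (homComp qq (s + k - u))).eval (γ ((n : ℝ) / N))
              / (Nat.factorial s : ℝ)) * ((m : ℝ) - (N : ℝ) * γ ((n : ℝ) / N)) ^ s)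
          - (homComp pp (k - u)).eval ((n : ℝ) / N)))
    ∧ ((bEval qq m N : ℝ) - (bEval pp n N : ℝ) =
      (N : ℝ) ^ (k - 1) * (homComp qq k).derivative.eval (γ ((n : ℝ) / N)) *
        ((m : ℝ) - (N : ℝ) * γ ((n : ℝ) / N) -
          ((homComp pp (k - 1)).eval ((n : ℝ) / N)
              - (homComp qq (k - 1)).eval (γ ((n : ℝ) / N)))
            / ((homComp qq k).derivative.eval (γ ((n : ℝ) / N))))
      + ∑ u ∈ Finset.Icc 2 k, (N : ℝ) ^ (k - u) *
          ((∑ s ∈ Finset.range (u + 1),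
              ((Polynomial.derivative^[s] (homComp qq (s + k - u))).eval (γ ((n : ℝ) / N))
                / (Nat.factorial s : ℝ)) * ((m : ℝ) - (N : ℝ) * γ ((n : ℝ) / N)) ^ s)
            - (homComp pp (k - u)).eval ((n : ℝ) / N))) := by
  have hNr : (N : ℝ) ≠ 0 := by positivity
  have hy : (0 : ℝ) < (n : ℝ) / N := by positivity
  have key : (bEval qq m N : ℝ) - (bEval pp n N : ℝ) =
      ∑ u ∈ Finset.range (k + 1), (N : ℝ) ^ (k - u) *
        ((∑ s ∈ Finset.range (u + 1),
            ((Polynomial.derivative^[s] (homComp qq (s + k - u))).eval (γ ((n : ℝ) / N))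
              / (Nat.factorial s : ℝ)) * ((m : ℝ) - (N : ℝ) * γ ((n : ℝ) / N)) ^ s)
          - (homComp pp (k - u)).eval ((n : ℝ) / N)) := by
    generalize γ ((n : ℝ) / N) = g
    simp only [mul_sub, Finset.sum_sub_distrib]
    congr 1
    · rw [aux_homog qq k hdq m N hN]
      have e1 := aux_flip k (fun s t => (N : ℝ) ^ t *
        (((Polynomial.derivative^[s] (homComp qq (s + t))).eval g
              / (Nat.factorial s : ℝ)) * ((m : ℝ) - (N : ℝ) * g) ^ s))
      calc _ = _ := ?_
        _ = _ := e1
        _ = _ := ?_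
      · refine Finset.sum_congr rfl fun j _ => ?_
        rw [aux_taylor _ j (aux_homComp_deg qq j) g, Finset.mul_sum]
        refine Finset.sum_congr rfl fun s hs => ?_
        have hs' : s ≤ j := Nat.lt_succ_iff.mp (Finset.mem_range.mp hs)
        obtain ⟨t, rfl⟩ := Nat.exists_eq_add_of_le hs'
        have : (m : ℝ) - N * g = N * ((m : ℝ) / N - g) := by field_simp
        simp only [Nat.add_sub_cancel_left]
        rw [this, mul_pow, pow_add]
        ring
      · refine Finset.sum_congr rfl fun u hu => ?_
        have hu' := Finset.mem_range.mp hu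
        rw [Finset.mul_sum]
        refine Finset.sum_congr rfl fun s _ => ?_
        rw [show s + k - u = s + (k - u) by omega]
    · rw [aux_homog pp k hdp n N hN, ← Finset.sum_range_reflect]
      rfl
  refine ⟨key, ?_⟩
  have hP := (aux_pos _ (aux_homComp_coeff pp k) hPk _ hy).1
  have hg : 0 < γ ((n : ℝ) / N) := by
    refine lt_of_le_of_ne (hγ0 _ hy.le) ?_
    intro h
    have := hγ _ hy.le
    rw [← h] at this
    linarith
  have hD := (aux_pos _ (aux_homComp_coeff qq k) hQk _ hg).2
  have hE := hγ _ hy.le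
  rw [key]
  generalize γ ((n : ℝ) / N) = g at *
  rw [Finset.range_eq_Ico, Finset.sum_eq_sum_Ico_succ_bot (by omega),
    Finset.sum_eq_sum_Ico_succ_bot (by omega)]
  rw [show Finset.Ico (0 + 1 + 1) (k + 1) = Finset.Icc 2 k by ext; simp only [Finset.mem_Ico, Finset.mem_Icc]; omega, ← add_assoc]
  congr 1
  simp only [zero_add, Finset.sum_range_succ, Finset.sum_range_zero, Function.iterate_zero, id,
    Function.iterate_one, Nat.sub_zero, Nat.add_sub_cancel_left, hE,
    Nat.factorial, pow_zero, pow_one]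
  push_cast
  field_simp
  ring
end
end

section
/- Dichotomy for linearly related polynomials: In the homogeneous decomposition setup, suppose there are constants c > 0 and r ∈ ℝ with γ_k(y) = c·y for all y ≥ 0 and R_k(y) = r for all y ∈ [0,1] (i.e., q and p are linearly related). Then either q and p have exploding differences, or else c and r are rational, there is an integer constant d such that q(cn+r, N) − p(n,N) = d for all n, N with cn+r a positive integer, and for every δ ∈ (0,1) there exist constants W_δ > 0 and N_δ such that for every N > N_δ, every integer n with δN ≤ n ≤ N and every positive integer m: either m = cn + r and q(m,N) − p(n,N) = d, or |q(m,N) − p(n,N)| ≥ W_δ·N^{k−1}. -/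
noncomputable section

namespace LRD

/-- The real bivariate sum. -/
def bsum (k : ℕ) (a : ℕ → ℕ → ℝ) (x N : ℝ) : ℝ :=
  ∑ s ∈ Finset.range (k + 1), ∑ t ∈ Finset.range (k + 1), a s t * x ^ s * N ^ t

/-- coefficients -/
def cf (Q : Polynomial (Polynomial ℕ)) (s t : ℕ) : ℝ := ((Q.coeff s).coeff t : ℝ)

lemma cf_nonneg (Q : Polynomial (Polynomial ℕ)) (s t : ℕ) : 0 ≤ cf Q s t := by
  unfold cf; positivity

lemma cf_zero (Q : Polynomial (Polynomial ℕ)) (k : ℕ) (h : diagDeg Q = k) (s t : ℕ)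
    (hst : k < s + t) : cf Q s t = 0 := by
  unfold cf
  have h1 : (Q.eval Polynomial.X).coeff (s + t) = 0 :=
    Polynomial.coeff_eq_zero_of_natDegree_lt (by unfold diagDeg at h; omega)
  rw [Polynomial.eval_eq_sum, Polynomial.sum_def, Polynomial.finset_sum_coeff] at h1
  by_cases hs : s ∈ Q.support
  · have h2 := (Finset.sum_eq_zero_iff.mp h1) s hs
    rw [add_comm s t, Polynomial.coeff_mul_X_pow] at h2
    exact_mod_cast h2
  · rw [Polynomial.notMem_support_iff.mp hs]; simp

lemma bEval_eq (Q : Polynomial (Polynomial ℕ)) (k : ℕ) (h : diagDeg Q = k) (n N : ℕ) :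
    (bEval Q n N : ℝ) = bsum k (cf Q) n N := by
  have hz := cf_zero Q k h
  have hd : ∀ s t, k < s + t → (Q.coeff s).coeff t = 0 := fun s t hst => by
    have := hz s t hst; unfold cf at this; exact_mod_cast this
  have h1 : Q.natDegree < k + 1 := by
    rw [Nat.lt_succ_iff, Polynomial.natDegree_le_iff_coeff_eq_zero]
    intro s hs
    ext t
    simpa using hd s t (by omega)
  have h2 : ∀ s, (Q.coeff s).natDegree < k + 1 := by
    intro s
    rw [Nat.lt_succ_iff, Polynomial.natDegree_le_iff_coeff_eq_zero]
    intro t ht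
    exact hd s t (by omega)
  unfold bEval bsum cf
  rw [Polynomial.eval_map, Polynomial.eval₂_eq_sum_range' _ h1]
  push_cast
  refine Finset.sum_congr rfl fun s _ => ?_
  rw [Polynomial.coe_evalRingHom, Polynomial.eval_eq_sum_range' (h2 s)]
  push_cast
  rw [Finset.sum_mul]
  refine Finset.sum_congr rfl fun t _ => ?_
  ring

lemma homComp_coeff (Q : Polynomial (Polynomial ℕ)) (u s : ℕ) :
    (homComp Q u).coeff s = if s ≤ u then cf Q s (u - s) else 0 := by
  unfold homComp cf
  simp [Polynomial.finset_sum_coeff, Polynomial.coeff_X_pow]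

/-- coefficients of the difference -/
def ee (k : ℕ) (a b : ℕ → ℕ → ℝ) (c r : ℝ) (u t : ℕ) : ℝ :=
  (∑ s ∈ Finset.range (k + 1), a s t * (s.choose u) * c ^ u * r ^ (s - u)) - b u t

lemma diff_eq (k : ℕ) (a b : ℕ → ℕ → ℝ) (c r x N : ℝ) :
    bsum k a (c * x + r) N - bsum k b x N = bsum k (ee k a b c r) x N := by
  have h1 : bsum k a (c * x + r) N = bsum k (fun u t =>
      ∑ s ∈ Finset.range (k + 1), a s t * (s.choose u) * c ^ u * r ^ (s - u)) x N := by
    unfold bsum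
    have : ∀ s ∈ Finset.range (k + 1), (c * x + r) ^ s =
        ∑ u ∈ Finset.range (k + 1), (s.choose u) * c ^ u * r ^ (s - u) * x ^ u := by
      intro s hs
      rw [add_pow]
      have hsub : Finset.range (s + 1) ⊆ Finset.range (k + 1) := by
        intro i; simp only [Finset.mem_range] at *; omega
      rw [← Finset.sum_subset hsub]
      · refine Finset.sum_congr rfl fun u _ => ?_
        rw [mul_pow]; ring
      · intro u _ hu
        rw [Nat.choose_eq_zero_of_lt (by simpa using hu)]; simp
    calc _ = ∑ s ∈ Finset.range (k + 1), ∑ t ∈ Finset.range (k + 1),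
          ∑ u ∈ Finset.range (k + 1),
            a s t * ((s.choose u) * c ^ u * r ^ (s - u) * x ^ u) * N ^ t := by
          refine Finset.sum_congr rfl fun s hs => Finset.sum_congr rfl fun t _ => ?_
          rw [this s hs, Finset.mul_sum, Finset.sum_mul]
      _ = ∑ t ∈ Finset.range (k + 1), ∑ s ∈ Finset.range (k + 1),
          ∑ u ∈ Finset.range (k + 1),
            a s t * ((s.choose u) * c ^ u * r ^ (s - u) * x ^ u) * N ^ t := Finset.sum_comm
      _ = ∑ t ∈ Finset.range (k + 1), ∑ u ∈ Finset.range (k + 1),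
          ∑ s ∈ Finset.range (k + 1),
            a s t * ((s.choose u) * c ^ u * r ^ (s - u) * x ^ u) * N ^ t :=
          Finset.sum_congr rfl fun t _ => Finset.sum_comm
      _ = ∑ u ∈ Finset.range (k + 1), ∑ t ∈ Finset.range (k + 1),
          ∑ s ∈ Finset.range (k + 1),
            a s t * ((s.choose u) * c ^ u * r ^ (s - u) * x ^ u) * N ^ t := Finset.sum_comm
      _ = _ := by
          refine Finset.sum_congr rfl fun u _ => Finset.sum_congr rfl fun t _ => ?_
          rw [Finset.sum_mul, Finset.sum_mul]
          refine Finset.sum_congr rfl fun s _ => ?_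
          ring
  rw [h1]
  unfold bsum ee
  rw [← Finset.sum_sub_distrib]
  refine Finset.sum_congr rfl fun u _ => ?_
  rw [← Finset.sum_sub_distrib]
  refine Finset.sum_congr rfl fun t _ => ?_
  ring

lemma ee_zero (k : ℕ) (hk : 1 < k) (a b : ℕ → ℕ → ℝ) (c r : ℝ)
    (ha : ∀ s t, k < s + t → a s t = 0) (hb : ∀ s t, k < s + t → b s t = 0)
    (h1 : ∀ u t, u + t = k → a u t * c ^ u = b u t)
    (h2 : ∀ u t, u + t = k - 1 → a u t * c ^ u + a (u + 1) t * (u + 1) * c ^ u * r = b u t)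
    (u t : ℕ) (hut : k - 2 < u + t) : ee k a b c r u t = 0 := by
  unfold ee
  rcases lt_trichotomy (u + t) k with h | h | h
  · have h' : u + t = k - 1 := by omega
    rw [← h2 u t h', sub_eq_zero]
    rw [← Finset.sum_subset (s₁ := {u, u + 1})]
    · rw [Finset.sum_pair (by omega)]
      simp
    · intro i; simp only [Finset.mem_insert, Finset.mem_singleton, Finset.mem_range]; omega
    · intro s _ hs
      simp only [Finset.mem_insert, Finset.mem_singleton, not_or] at hs
      rcases lt_or_ge s u with hlt | hge
      · rw [Nat.choose_eq_zero_of_lt hlt]; simp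
      · rw [ha s t (by omega)]; simp
  · rw [← h1 u t h, sub_eq_zero]
    rw [Finset.sum_eq_single u]
    · simp
    · intro s _ hs
      rcases lt_or_ge s u with hlt | hge
      · rw [Nat.choose_eq_zero_of_lt hlt]; simp
      · rw [ha s t (by omega)]; simp
    · intro hu; simp at hu; omega
  · rw [hb u t h, sub_zero]
    refine Finset.sum_eq_zero fun s _ => ?_
    rcases lt_or_ge s u with hlt | hge
    · rw [Nat.choose_eq_zero_of_lt hlt]; simp
    · rw [ha s t (by omega)]; simp

/-- crude upper bound for a bivariate sum. -/
lemma bsum_bound (k : ℕ) (e : ℕ → ℕ → ℝ) (j : ℕ) (he : ∀ u t, j < u + t → e u t = 0) :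
    ∃ K : ℝ, 0 ≤ K ∧ ∀ x N : ℝ, 1 ≤ N → 0 ≤ x → x ≤ N → |bsum k e x N| ≤ K * N ^ j := by
  refine ⟨∑ s ∈ Finset.range (k + 1), ∑ t ∈ Finset.range (k + 1), |e s t|, by positivity, ?_⟩
  intro x N hN hx hxN
  unfold bsum
  rw [Finset.sum_mul]
  refine (Finset.abs_sum_le_sum_abs _ _).trans (Finset.sum_le_sum fun s _ => ?_)
  rw [Finset.sum_mul]
  refine (Finset.abs_sum_le_sum_abs _ _).trans (Finset.sum_le_sum fun t _ => ?_)
  by_cases h : j < s + t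
  · simp [he s t h]
  · rw [mul_assoc, abs_mul]
    refine mul_le_mul_of_nonneg_left ?_ (abs_nonneg _)
    rw [abs_of_nonneg (by positivity)]
    calc x ^ s * N ^ t ≤ N ^ s * N ^ t := by gcongr
      _ = N ^ (s + t) := by rw [pow_add]
      _ ≤ N ^ j := pow_le_pow_right₀ hN (by omega)

lemma pow_sub_ge (x m : ℝ) (hx : 0 ≤ x) (hxm : x ≤ m) (s : ℕ) (hs : 1 ≤ s) :
    x ^ (s - 1) * (m - x) ≤ m ^ s - x ^ s := by
  obtain ⟨s, rfl⟩ : ∃ s', s = s' + 1 := ⟨s - 1, by omega⟩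
  have : x ^ s ≤ m ^ s := by gcongr
  have hm : 0 ≤ m := hx.trans hxm
  simp only [Nat.add_sub_cancel]
  nlinarith [mul_le_mul_of_nonneg_right this hm, pow_succ x s, pow_succ m s]

lemma pow_sub_ge' (x m : ℝ) (hm : 0 ≤ m) (hxm : m ≤ x) (s : ℕ) (hs : 1 ≤ s) :
    x ^ (s - 1) * (x - m) ≤ x ^ s - m ^ s := by
  obtain ⟨s, rfl⟩ : ∃ s', s = s' + 1 := ⟨s - 1, by omega⟩
  have : m ^ s ≤ x ^ s := by gcongr
  simp only [Nat.add_sub_cancel]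
  nlinarith [mul_le_mul_of_nonneg_right this hm, pow_succ x s, pow_succ m s]

lemma bsum_single (k : ℕ) (a : ℕ → ℕ → ℝ) (ha : ∀ s t, 0 ≤ a s t) (x m N : ℝ)
    (hx : 0 ≤ x) (hxm : x ≤ m) (hN : 0 ≤ N) (s t : ℕ) (hs : s ≤ k) (ht : t ≤ k) :
    a s t * (m ^ s - x ^ s) * N ^ t ≤ bsum k a m N - bsum k a x N := by
  have h0 : ∀ s t, 0 ≤ a s t * (m ^ s - x ^ s) * N ^ t := fun s t => by
    have : x ^ s ≤ m ^ s := by gcongr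
    have := sub_nonneg.mpr this
    have := ha s t
    positivity
  have : bsum k a m N - bsum k a x N = ∑ s ∈ Finset.range (k + 1),
      ∑ t ∈ Finset.range (k + 1), a s t * (m ^ s - x ^ s) * N ^ t := by
    unfold bsum
    rw [← Finset.sum_sub_distrib]
    refine Finset.sum_congr rfl fun u _ => ?_
    rw [← Finset.sum_sub_distrib]
    refine Finset.sum_congr rfl fun t _ => ?_
    ring
  rw [this]
  refine le_trans ?_ (Finset.single_le_sum (f := fun s => ∑ t ∈ Finset.range (k + 1),
    a s t * (m ^ s - x ^ s) * N ^ t) (fun i _ => Finset.sum_nonneg fun t _ => h0 i t)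
    (Finset.mem_range.mpr (Nat.lt_succ_of_le hs)))
  exact Finset.single_le_sum (f := fun t => a s t * (m ^ s - x ^ s) * N ^ t)
    (fun i _ => h0 s i) (Finset.mem_range.mpr (Nat.lt_succ_of_le ht))

lemma bsum_lower (k : ℕ) (a : ℕ → ℕ → ℝ) (ha : ∀ s t, 0 ≤ a s t) (x m N : ℝ)
    (hx : 0 ≤ x) (hm : 0 ≤ m) (hN : 0 ≤ N) (s t : ℕ) (h1 : 1 ≤ s) (hs : s ≤ k) (ht : t ≤ k) :
    a s t * x ^ (s - 1) * N ^ t * |m - x| ≤ |bsum k a m N - bsum k a x N| := by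
  have hN' : 0 ≤ a s t * N ^ t := mul_nonneg (ha s t) (by positivity)
  rcases le_total x m with h | h
  · rw [abs_of_nonneg (sub_nonneg.mpr h)]
    refine le_trans ?_ (le_abs_self _)
    refine le_trans ?_ (bsum_single k a ha x m N hx h hN s t hs ht)
    nlinarith [mul_le_mul_of_nonneg_left (pow_sub_ge x m hx h s h1) hN']
  · rw [abs_sub_comm m x, abs_sub_comm (bsum k a m N), abs_of_nonneg (sub_nonneg.mpr h)]
    refine le_trans ?_ (le_abs_self _)
    refine le_trans ?_ (bsum_single k a ha m x N hm h hN s t hs ht)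
    nlinarith [mul_le_mul_of_nonneg_left (pow_sub_ge' x m hm h s h1) hN']

/-- Off the line, the difference is large. -/
lemma off_line (k : ℕ) (hk : 1 < k) (a b : ℕ → ℕ → ℝ) (ha : ∀ s t, 0 ≤ a s t) (c r : ℝ)
    (hc : 0 < c) (s₀ t₀ : ℕ) (hs₀ : 1 ≤ s₀) (hst : s₀ + t₀ = k) (hpos : 0 < a s₀ t₀)
    (he : ∀ u t, k - 2 < u + t → ee k a b c r u t = 0)
    (η : ℝ) (hη : 0 < η) (δ : ℝ) (hδ : 0 < δ) :
    ∃ W : ℝ, 0 < W ∧ ∃ N₀ : ℕ, ∀ N : ℕ, N₀ < N → ∀ n : ℕ, δ * N ≤ (n : ℝ) → n ≤ N →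
      ∀ m : ℕ, η ≤ |(m : ℝ) - (c * n + r)| →
        W * (N : ℝ) ^ (k - 1) ≤ |bsum k a m N - bsum k b n N| := by
  obtain ⟨K, hK, hKb⟩ := bsum_bound k _ _ he
  set κ := a s₀ t₀ * (c * δ / 2) ^ (s₀ - 1) * η with hκ
  have hκpos : 0 < κ := by positivity
  refine ⟨κ / 2, by positivity, ⌈2 * |r| / (c * δ)⌉₊ + ⌈2 * K / κ⌉₊ + 1, ?_⟩
  intro N hN n hn hnN m hm
  have hN1 : 2 * |r| / (c * δ) ≤ N := (Nat.le_ceil _).trans (by exact_mod_cast (by omega))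
  have hN2 : 2 * K / κ ≤ N := (Nat.le_ceil _).trans (by exact_mod_cast (by omega))
  have hN3 : (1 : ℝ) ≤ N := by exact_mod_cast (by omega)
  rw [div_le_iff₀ (by positivity)] at hN1 hN2
  have hx : c * δ / 2 * N ≤ c * n + r := by
    have := neg_abs_le r
    nlinarith [mul_le_mul_of_nonneg_left hn hc.le]
  have hx0 : 0 ≤ c * n + r := le_trans (by positivity) hx
  have hl := bsum_lower k a ha (c * n + r) m N hx0 (by positivity) (by positivity) s₀ t₀ hs₀
    (by omega) (by omega)
  have hD := hKb n N hN3 (by positivity) (by exact_mod_cast hnN)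
  rw [← diff_eq] at hD
  have h1 : κ * (N : ℝ) ^ (k - 1) ≤
      a s₀ t₀ * (c * n + r) ^ (s₀ - 1) * N ^ t₀ * |(m : ℝ) - (c * n + r)| := by
    have e1 : (N : ℝ) ^ (k - 1) = N ^ (s₀ - 1) * N ^ t₀ := by
      rw [← pow_add]; congr 1; omega
    calc κ * (N : ℝ) ^ (k - 1) = a s₀ t₀ * (c * δ / 2 * N) ^ (s₀ - 1) * N ^ t₀ * η := by
          rw [hκ, e1, mul_pow (c * δ / 2)]; ring
      _ ≤ _ := by gcongr
  have h2 : K * (N : ℝ) ^ (k - 2) ≤ κ / 2 * N ^ (k - 1) := by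
    have e1 : (N : ℝ) ^ (k - 1) = N ^ (k - 2) * N := by
      rw [← pow_succ]; congr 1; omega
    rw [e1]
    have : (0 : ℝ) ≤ N ^ (k - 2) := by positivity
    nlinarith
  have h3 := abs_sub_abs_le_abs_sub (bsum k a m N - bsum k a (c * n + r) N)
    (-(bsum k a (c * n + r) N - bsum k b n N))
  rw [abs_neg] at h3
  have h4 : bsum k a m N - bsum k a (c * n + r) N - -(bsum k a (c * n + r) N - bsum k b n N)
    = bsum k a m N - bsum k b n N := by ring
  rw [h4] at h3
  linarith

/-- counting lemma near a point -/
lemma card_near (ρ ε : ℝ) (hε : 0 < ε) (N : ℕ) :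
    (((Finset.Icc 1 N).filter (fun n : ℕ => |(n : ℝ) - ρ| < ε)).card : ℝ) ≤ 2 * ε + 1 := by
  classical
  have hsub : (((Finset.Icc 1 N).filter (fun n : ℕ => |(n : ℝ) - ρ| < ε)).image
      (fun n : ℕ => (n : ℤ))) ⊆ Finset.Icc ⌈ρ - ε⌉ ⌊ρ + ε⌋ := by
    intro z hz
    simp only [Finset.mem_image, Finset.mem_filter] at hz
    obtain ⟨n, ⟨_, h⟩, rfl⟩ := hz
    rw [abs_lt] at h
    rw [Finset.mem_Icc, Int.ceil_le, Int.le_floor]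
    push_cast
    constructor <;> linarith
  have hc := Finset.card_le_card hsub
  rw [Finset.card_image_of_injective _ Nat.cast_injective, Int.card_Icc] at hc
  have h1 : ((⌊ρ + ε⌋ + 1 - ⌈ρ - ε⌉).toNat : ℝ) ≤ 2 * ε + 1 := by
    rcases le_total 0 (⌊ρ + ε⌋ + 1 - ⌈ρ - ε⌉) with h | h
    · have : ((⌊ρ + ε⌋ + 1 - ⌈ρ - ε⌉).toNat : ℝ) = ((⌊ρ + ε⌋ + 1 - ⌈ρ - ε⌉ : ℤ) : ℝ) := by
        exact_mod_cast congrArg (Int.cast : ℤ → ℝ) (Int.toNat_of_nonneg h)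
      rw [this]
      push_cast
      have := Int.floor_le (ρ + ε)
      have := Int.le_ceil (ρ - ε)
      linarith
    · rw [Int.toNat_of_nonpos h]; simp; positivity
  exact le_trans (by exact_mod_cast hc) h1

lemma card_poly (E : Polynomial ℝ) (hE : E ≠ 0) (δ : ℝ) (hδ : 0 < δ) :
    ∃ η : ℝ, 0 < η ∧ ∃ N₀ : ℕ, ∀ N : ℕ, N₀ < N →
      (((Finset.Icc 1 N).filter (fun n : ℕ => |E.eval ((n : ℝ) / N)| < η)).card : ℝ)
        ≤ δ * N := by
  classical
  set R := E.roots.toFinset with hR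
  set ε := δ / (4 * (R.card + 1)) with hε
  have hεpos : 0 < ε := by positivity
  set S : Set ℝ := Set.Icc 0 1 ∩ ⋂ ρ ∈ R, {y | ε ≤ |y - ρ|} with hS
  have hScomp : IsCompact S := by
    refine isCompact_Icc.inter_right ?_
    refine isClosed_biInter fun ρ _ => ?_
    exact isClosed_le continuous_const (by fun_prop)
  have hη : ∃ η : ℝ, 0 < η ∧ ∀ y ∈ S, η ≤ |E.eval y| := by
    rcases S.eq_empty_or_nonempty with h | h
    · exact ⟨1, one_pos, by simp [h]⟩
    · obtain ⟨y, hy, hmin⟩ := hScomp.exists_isMinOn h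
        (f := fun y => |E.eval y|) (by fun_prop)
      refine ⟨|E.eval y|, ?_, fun z hz => hmin hz⟩
      rw [abs_pos]
      intro h0
      have hyR : y ∈ R := by
        rw [hR, Multiset.mem_toFinset, Polynomial.mem_roots hE]; exact h0
      have := Set.mem_iInter₂.mp hy.2 y hyR
      simp at this
      linarith
  obtain ⟨η, hη, hmin⟩ := hη
  refine ⟨η, hη, ⌈2 * (R.card : ℝ) / δ⌉₊, fun N hN => ?_⟩
  have hN1 : 2 * (R.card : ℝ) / δ ≤ N := (Nat.le_ceil _).trans (by exact_mod_cast hN.le)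
  rw [div_le_iff₀ hδ] at hN1
  have hN0 : (0 : ℝ) < N := by exact_mod_cast (by omega)
  have hsub : (Finset.Icc 1 N).filter (fun n : ℕ => |E.eval ((n : ℝ) / N)| < η) ⊆
      R.biUnion fun ρ => (Finset.Icc 1 N).filter (fun n : ℕ => |(n : ℝ) - ρ * N| < ε * N) := by
    intro n hn
    simp only [Finset.mem_filter, Finset.mem_biUnion] at hn ⊢
    by_contra hcon
    push Not at hcon
    have : (n : ℝ) / N ∈ S := by
      have h1 := Finset.mem_Icc.mp hn.1
      refine ⟨⟨by positivity, ?_⟩, ?_⟩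
      · rw [div_le_one hN0]; exact_mod_cast h1.2
      · rw [Set.mem_iInter₂]
        intro ρ hρ
        have := hcon ρ hρ hn.1
        have e1 : (n : ℝ) - ρ * N = (n / N - ρ) * N := by field_simp
        rw [e1, abs_mul, abs_of_pos hN0] at this
        exact le_of_mul_le_mul_right this hN0
    have := hmin _ this
    linarith [hn.2]
  have h1 : (((Finset.Icc 1 N).filter (fun n : ℕ => |E.eval ((n : ℝ) / N)| < η)).card : ℝ)
      ≤ ∑ ρ ∈ R, (2 * (ε * N) + 1) := by
    refine le_trans (Nat.cast_le.mpr ((Finset.card_le_card hsub).trans Finset.card_biUnion_le)) ?_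
    push_cast
    exact Finset.sum_le_sum fun ρ _ => card_near _ _ (by positivity) N
  refine h1.trans ?_
  rw [Finset.sum_const, nsmul_eq_mul]
  have h2 : (R.card : ℝ) * ε ≤ δ / 4 := by
    rw [hε, mul_div_assoc', div_le_div_iff₀ (by positivity) (by norm_num)]
    nlinarith
  nlinarith [mul_le_mul_of_nonneg_right h2 hN0.le]

lemma card_irr (c r : ℝ) (hc : Irrational c) (δ : ℝ) (hδ : 0 < δ) :
    ∃ η : ℝ, 0 < η ∧ ∃ N₀ : ℕ, ∀ N : ℕ, N₀ < N → ∀ B : Finset ℕ, B ⊆ Finset.Icc 1 N →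
      (∀ n ∈ B, ∃ m : ℕ, |(m : ℝ) - (c * n + r)| < η) → (B.card : ℝ) ≤ δ * N := by
  set L := ⌈2 / δ⌉₊ + 1 with hL
  have hη : ∀ J : ℕ, ∃ η : ℝ, 0 < η ∧ ∀ j : ℕ, 0 < j → j < J → ∀ z : ℤ, 2 * η ≤ |z - c * j| := by
    intro J
    induction J with
    | zero => exact ⟨1, one_pos, by intro j _ h; omega⟩
    | succ J ih =>
      obtain ⟨η, hη, h⟩ := ih
      rcases Nat.eq_zero_or_pos J with hJ | hJ
      · exact ⟨1, one_pos, by intro j _ h; omega⟩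
      have hpos : 0 < |c * J - round (c * J)| := by
        rw [abs_pos, sub_ne_zero]
        exact (hc.mul_natCast hJ.ne').ne_int _
      refine ⟨min η (|c * J - round (c * J)| / 2), lt_min hη (by positivity), ?_⟩
      intro j hj hjJ z
      rcases Nat.lt_succ_iff_lt_or_eq.mp hjJ with h1 | rfl
      · have := h j hj h1 z
        linarith [min_le_left η (|c * J - round (c * J)| / 2)]
      · have := round_le (c * j) z
        rw [abs_sub_comm (z : ℝ)]
        linarith [min_le_right η (|c * j - round (c * j)| / 2)]
  obtain ⟨η, hη, hsep⟩ := hη L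
  refine ⟨η, hη, ⌈2 / δ⌉₊, fun N hN B hB hm => ?_⟩
  have hsep' : ∀ n₁ ∈ B, ∀ n₂ ∈ B, n₁ < n₂ → L ≤ n₂ - n₁ := by
    intro n₁ h₁ n₂ h₂ hlt
    by_contra hcon
    obtain ⟨m₁, hm₁⟩ := hm n₁ h₁
    obtain ⟨m₂, hm₂⟩ := hm n₂ h₂
    have := hsep (n₂ - n₁) (by omega) (by omega) ((m₂ : ℤ) - m₁)
    push_cast [Nat.cast_sub hlt.le] at this
    have e : ((m₂ : ℝ) - m₁ - c * (n₂ - n₁)) =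
      (m₂ - (c * n₂ + r)) - (m₁ - (c * n₁ + r)) := by ring
    rw [e] at this
    have := abs_sub ((m₂ : ℝ) - (c * n₂ + r)) (m₁ - (c * n₁ + r))
    linarith
  have hLpos : 0 < L := by omega
  have hinj : Set.InjOn (fun n => n / L) (B : Set ℕ) := by
    have key : ∀ n₁ ∈ B, ∀ n₂ ∈ B, n₁ < n₂ → n₁ / L ≠ n₂ / L := by
      intro n₁ h₁ n₂ h₂ hlt
      have h3 := hsep' n₁ h₁ n₂ h₂ hlt
      have h4 : (n₁ + L) / L ≤ n₂ / L := Nat.div_le_div_right (by omega)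
      rw [Nat.add_div_right _ hLpos] at h4
      omega
    intro n₁ h₁ n₂ h₂ heq
    rcases lt_trichotomy n₁ n₂ with h | h | h
    · exact absurd heq (key n₁ h₁ n₂ h₂ h)
    · exact h
    · exact absurd heq.symm (key n₂ h₂ n₁ h₁ h)
  have hcard : B.card ≤ N / L + 1 := by
    rw [← Finset.card_range (N / L + 1)]
    refine Finset.card_le_card_of_injOn (fun n => n / L) ?_ hinj
    intro n hn
    have := (Finset.mem_Icc.mp (hB hn)).2
    simp only [Finset.coe_range, Set.mem_Iio]
    exact Nat.lt_succ_of_le (Nat.div_le_div_right this)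
  have h1 : (B.card : ℝ) ≤ (N : ℝ) / L + 1 := by
    refine le_trans (Nat.cast_le.mpr hcard) ?_
    push_cast
    linarith [@Nat.cast_div_le ℝ _ _ _ N L]
  have h2 : 2 / δ ≤ L := (Nat.le_ceil _).trans (by exact_mod_cast (by omega))
  have h3 : 2 / δ ≤ N := (Nat.le_ceil _).trans (by exact_mod_cast hN.le)
  rw [div_le_iff₀ hδ] at h2 h3
  have hL0 : (0 : ℝ) < L := by exact_mod_cast hLpos
  have hN0 : (0 : ℝ) ≤ N := by positivity
  have h4 : (N : ℝ) / L ≤ δ / 2 * N := by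
    rw [div_le_iff₀ hL0]; nlinarith
  linarith

lemma rat_gap (c r : ℝ) (cq : ℚ) (hcq : (cq : ℝ) = c) :
    ∃ η : ℝ, 0 < η ∧ ∀ n m : ℕ, (m : ℝ) = c * n + r ∨ η ≤ |(m : ℝ) - (c * n + r)| := by
  set b : ℝ := (cq.den : ℝ) with hb
  have hbpos : 0 < b := by rw [hb]; exact_mod_cast cq.den_pos
  have hgap : ∀ ρ : ℝ, ∃ η : ℝ, 0 < η ∧ ∀ z : ℤ, (z : ℝ) = ρ ∨ η ≤ |(z : ℝ) - ρ| := by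
    intro ρ
    by_cases h : ∃ w : ℤ, (w : ℝ) = ρ
    · obtain ⟨w, rfl⟩ := h
      refine ⟨1, one_pos, fun z => ?_⟩
      by_cases hzw : z = w
      · left; rw [hzw]
      · right
        have := Int.one_le_abs (sub_ne_zero.mpr hzw)
        exact_mod_cast this
    · push Not at h
      refine ⟨|ρ - round ρ|, abs_pos.mpr (sub_ne_zero.mpr (h _).symm), fun z => Or.inr ?_⟩
      rw [abs_sub_comm (z : ℝ)]
      exact round_le ρ z
  obtain ⟨η, hη, h⟩ := hgap (b * r)
  have hcb : c * b = cq.num := by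
    rw [← hcq, hb]; exact_mod_cast Rat.mul_den_eq_num cq
  refine ⟨η / b, by positivity, fun n m => ?_⟩
  have e : (((cq.den : ℤ) * m - cq.num * n : ℤ) : ℝ) - b * r = b * (m - (c * n + r)) := by
    push_cast
    rw [← hcb, hb]; ring
  rcases h ((cq.den : ℤ) * m - cq.num * n) with h1 | h1
  · left
    rw [h1, sub_self] at e
    have := (mul_eq_zero.mp e.symm).resolve_left hbpos.ne'
    linarith
  · right
    rw [e, abs_mul, abs_of_pos hbpos] at h1
    rw [div_le_iff₀ hbpos]; linarith

lemma exploding_of (q p : ℕ → ℕ → ℕ)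
    (h : ∀ δ : ℝ, 0 < δ → δ < 1 → ∃ C : ℝ, 0 < C ∧ ∃ N₀ : ℕ, ∃ B : ℕ → ℕ → Prop,
      (∀ N : ℕ, N₀ < N → ∀ S : Finset ℕ, S ⊆ Finset.Icc 1 N → (∀ n ∈ S, B N n) →
        (S.card : ℝ) ≤ δ * N) ∧
      ∀ N : ℕ, N₀ < N → ∀ n : ℕ, δ * N ≤ (n : ℝ) → n ≤ N → ¬ B N n →
        ∀ m : ℕ, 0 < m → C * N ≤ |(q m N : ℝ) - (p n N : ℝ)|) : ExplodingDiff q p := by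
  classical
  intro δ hδ hδ1
  obtain ⟨C, hC, N₀, B, hB1, hB2⟩ := h δ hδ hδ1
  refine ⟨C, hC, N₀, fun N => if N₀ < N then (Finset.Icc 1 N).filter (B N) else ∅, ?_, ?_, ?_⟩
  · intro N
    by_cases hN : N₀ < N
    · simp only [hN, if_true]
      exact hB1 N hN _ (Finset.filter_subset _ _) (fun n hn => (Finset.mem_filter.mp hn).2)
    · simp only [hN, if_false, Finset.card_empty]; push_cast; positivity
  · intro N
    by_cases hN : N₀ < N
    · simp only [hN, if_true]
      intro n hn
      exact Finset.mem_Icc.mp (Finset.mem_filter.mp hn).1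
    · simp [hN]
  · intro N hN n hn hnN hnB m hm _
    have hN0 : (0 : ℝ) < N := by exact_mod_cast (by omega)
    have hm0 : 0 < m := by
      have : (0 : ℝ) < m := lt_of_lt_of_le (by positivity) hm
      exact_mod_cast this
    have hn0 : 0 < n := by
      have : (0 : ℝ) < n := lt_of_lt_of_le (by positivity) hn
      exact_mod_cast this
    refine hB2 N hN n hn hnN ?_ m hm0
    intro hb
    apply hnB
    simp only [hN, if_true]
    exact Finset.mem_filter.mpr ⟨Finset.mem_Icc.mpr ⟨hn0, hnN⟩, hb⟩

/-- Nonconstant bivariate sums are large for most `n`. -/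
lemma nonconst_large (k : ℕ) (e : ℕ → ℕ → ℝ) (he : ∀ u t, k < u + t → e u t = 0)
    (u₁ t₁ : ℕ) (h1 : 0 < u₁ + t₁) (hne : e u₁ t₁ ≠ 0) (δ : ℝ) (hδ : 0 < δ) :
    ∃ C : ℝ, 0 < C ∧ ∃ N₀ : ℕ, ∃ B : ℕ → ℕ → Prop,
      (∀ N : ℕ, N₀ < N → ∀ S : Finset ℕ, S ⊆ Finset.Icc 1 N → (∀ n ∈ S, B N n) →
        (S.card : ℝ) ≤ δ * N) ∧
      ∀ N : ℕ, N₀ < N → ∀ n : ℕ, n ≤ N → ¬ B N n → C * N ≤ |bsum k e n N| := by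
  classical
  obtain ⟨j, ⟨u₂, t₂, hj, hne2⟩, hmax⟩ : ∃ j, (∃ u t, u + t = j ∧ e u t ≠ 0) ∧
      ∀ u t, j < u + t → e u t = 0 := by
    let P : ℕ → Prop := fun j => ∃ u t, u + t = j ∧ e u t ≠ 0
    have hP : P (u₁ + t₁) := ⟨u₁, t₁, rfl, hne⟩
    have hle : u₁ + t₁ ≤ k := by
      by_contra hcon; exact hne (he _ _ (by omega))
    refine ⟨Nat.findGreatest P k, Nat.findGreatest_spec hle hP, ?_⟩
    intro u t hut
    by_contra hcon
    by_cases hk : u + t ≤ k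
    · exact Nat.findGreatest_is_greatest hut hk ⟨u, t, rfl, hcon⟩
    · exact hcon (he _ _ (by omega))
  have hjpos : 0 < j := by
    by_contra hcon; exact hne (hmax _ _ (by omega))
  have hjk : j ≤ k := by
    by_contra hcon; exact hne2 (he _ _ (by omega))
  set E : Polynomial ℝ := ∑ u ∈ Finset.range (j + 1),
    Polynomial.C (e u (j - u)) * Polynomial.X ^ u with hE
  have hE0 : E ≠ 0 := by
    intro h0
    have : E.coeff u₂ = e u₂ t₂ := by
      rw [hE]
      simp only [Polynomial.finset_sum_coeff, Polynomial.coeff_C_mul, Polynomial.coeff_X_pow]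
      rw [Finset.sum_eq_single u₂]
      · simp; congr 1; omega
      · intro b _ hb; simp [hb.symm]
      · intro h; simp at h; omega
    rw [h0] at this
    exact hne2 (by simpa using this.symm)
  obtain ⟨η, hη, N₁, hcard⟩ := card_poly E hE0 δ hδ
  -- lower order part
  set e' : ℕ → ℕ → ℝ := fun u t => if u + t = j then 0 else e u t with he'
  obtain ⟨K, hK, hKb⟩ := bsum_bound k e' (j - 1) (by
    intro u t hut
    rw [he']
    by_cases h : u + t = j
    · simp [h]
    · simp only [h, if_false]; exact hmax _ _ (by omega))
  have hsplit : ∀ x N : ℝ, 0 < N → bsum k e x N = bsum k e' x N + N ^ j * E.eval (x / N) := by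
    intro x N hN
    have h2 : N ^ j * E.eval (x / N) = bsum k (fun u t => if u + t = j then e u t else 0) x N := by
      rw [hE]
      unfold bsum
      simp only [Polynomial.eval_finset_sum, Polynomial.eval_mul, Polynomial.eval_C,
        Polynomial.eval_pow, Polynomial.eval_X]
      rw [Finset.mul_sum]
      have hsub : Finset.range (j + 1) ⊆ Finset.range (k + 1) := by
        intro i; simp only [Finset.mem_range]; omega
      rw [← Finset.sum_subset hsub]
      · refine Finset.sum_congr rfl fun u hu => ?_
        have hu' : u ≤ j := Nat.lt_succ_iff.mp (Finset.mem_range.mp hu)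
        rw [Finset.sum_eq_single (j - u)]
        · rw [if_pos (by omega)]
          have : N ^ j = N ^ u * N ^ (j - u) := by rw [← pow_add]; congr 1; omega
          rw [this, div_pow]
          field_simp
        · intro t _ ht
          rw [if_neg (by omega)]; simp
        · intro h; simp at h; omega
      · intro u _ hu
        refine Finset.sum_eq_zero fun t _ => ?_
        simp at hu
        rw [if_neg (by omega)]; simp
    rw [h2]
    unfold bsum
    rw [← Finset.sum_add_distrib]
    refine Finset.sum_congr rfl fun u _ => ?_
    rw [← Finset.sum_add_distrib]
    refine Finset.sum_congr rfl fun t _ => ?_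
    rw [he']
    by_cases h : u + t = j <;> simp [h]
  refine ⟨η / 2, by positivity, N₁ + ⌈2 * K / η⌉₊ + 1,
    fun N n => |E.eval ((n : ℝ) / N)| < η, ?_, ?_⟩
  · intro N hN S hS hSB
    refine le_trans ?_ (hcard N (by omega))
    exact_mod_cast Finset.card_le_card fun n hn => Finset.mem_filter.mpr ⟨hS hn, hSB n hn⟩
  · intro N hN n hnN hB
    have hN2 : 2 * K / η ≤ N := (Nat.le_ceil _).trans (by exact_mod_cast (by omega))
    have hN3 : (1 : ℝ) ≤ N := by exact_mod_cast (by omega)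
    rw [div_le_iff₀ hη] at hN2
    push Not at hB
    have hb := hKb n N hN3 (by positivity) (by exact_mod_cast hnN)
    rw [hsplit n N (by linarith)]
    have h3 : η * (N : ℝ) ^ j ≤ |(N : ℝ) ^ j * E.eval ((n : ℝ) / N)| := by
      rw [abs_mul, abs_of_nonneg (by positivity : (0 : ℝ) ≤ (N : ℝ) ^ j), mul_comm]
      gcongr
    have h4 := abs_sub_abs_le_abs_sub ((N : ℝ) ^ j * E.eval ((n : ℝ) / N)) (-bsum k e' n N)
    rw [abs_neg, sub_neg_eq_add, add_comm _ (bsum k e' n N)] at h4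
    have e1 : (N : ℝ) ^ j = N ^ (j - 1) * N := by
      rw [← pow_succ]; congr 1; omega
    have h5 : (1 : ℝ) ≤ N ^ (j - 1) := one_le_pow₀ hN3
    rw [e1] at h3
    have h6 : K * (N : ℝ) ^ (j - 1) ≤ η / 2 * (N ^ (j - 1) * N) := by nlinarith
    have h7 : η / 2 * N ≤ η / 2 * ((N : ℝ) ^ (j - 1) * N) := by
      refine mul_le_mul_of_nonneg_left ?_ (by positivity)
      nlinarith
    rw [e1] at h4
    rw [e1]
    linarith

lemma const_of (k : ℕ) (e : ℕ → ℕ → ℝ) (h : ∀ u t, 0 < u + t → e u t = 0) (x N : ℝ) :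
    bsum k e x N = e 0 0 := by
  unfold bsum
  rw [Finset.sum_eq_single 0, Finset.sum_eq_single 0]
  · simp
  · intro t _ ht; rw [h 0 t (by omega)]; simp
  · simp
  · intro u _ hu
    refine Finset.sum_eq_zero fun t _ => ?_
    rw [h u t (by omega)]; simp
  · simp

end LRD

/-- Dichotomy for linearly related polynomials (Corollary 3.5 of the paper):
if `γ_k(y) = c·y` and `R_k(y) = r` then either `q` and `p` have exploding
differences, or `c` and `r` are rational, `q(cn+r,N) − p(n,N)` is a constant `d`,
and away from the arithmetic progression `m = cn + r` the difference
`|q(m,N) − p(n,N)|` is at least `W_δ·N^{k−1}`. -/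
theorem linearly_related_dichotomy
    (qq pp : Polynomial (Polynomial ℕ)) (k : ℕ) (hk : 1 < k)
    (hdq : diagDeg qq = k) (hdp : diagDeg pp = k)
    (hqn : 0 < qq.natDegree) (hpn : 0 < pp.natDegree)
    (hQk : (homComp qq k).natDegree ≠ 0) (hPk : (homComp pp k).natDegree ≠ 0)
    (h0 : (homComp qq k).eval 0 ≤ (homComp pp k).eval 0)
    -- γ = Q_k^{-1} ∘ P_k on [0,∞)
    (γ : ℝ → ℝ) (hγ0 : ∀ y : ℝ, 0 ≤ y → 0 ≤ γ y)
    (hγ : ∀ y : ℝ, 0 ≤ y → (homComp qq k).eval (γ y) = (homComp pp k).eval y)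
    (c r : ℝ) (hc : 0 < c)
    (hγlin : ∀ y : ℝ, 0 ≤ y → γ y = c * y)
    (hRconst : ∀ y ∈ Set.Icc (0 : ℝ) 1,
      ((homComp pp (k - 1)).eval y - (homComp qq (k - 1)).eval (γ y))
        / ((homComp qq k).derivative.eval (γ y)) = r) :
    ExplodingDiff (bEval qq) (bEval pp) ∨
      ((∃ cq : ℚ, (cq : ℝ) = c) ∧ (∃ rq : ℚ, (rq : ℝ) = r) ∧
        ∃ d : ℤ,
          (∀ n N m : ℕ, 0 < n → 0 < N → 0 < m → (m : ℝ) = c * n + r →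
            (bEval qq m N : ℤ) - (bEval pp n N : ℤ) = d) ∧
          ∀ δ : ℝ, 0 < δ → δ < 1 → ∃ W : ℝ, 0 < W ∧ ∃ N₀ : ℕ,
            ∀ N : ℕ, N₀ < N → ∀ n : ℕ, δ * N ≤ (n : ℝ) → n ≤ N →
              ∀ m : ℕ, 0 < m →
                ((m : ℝ) = c * n + r ∧ (bEval qq m N : ℤ) - (bEval pp n N : ℤ) = d) ∨
                W * (N : ℝ) ^ (k - 1) ≤ |(bEval qq m N : ℝ) - (bEval pp n N : ℝ)|) := by
  classical
  set Qk := homComp qq k with hQkdef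
  set Pk := homComp pp k with hPkdef
  set a := LRD.cf qq with ha_def
  set b := LRD.cf pp with hb_def
  have ha := LRD.cf_nonneg qq
  have haz := LRD.cf_zero qq k hdq
  have hbz := LRD.cf_zero pp k hdp
  have hq := LRD.bEval_eq qq k hdq
  have hp := LRD.bEval_eq pp k hdp
  -- polynomial identities
  have id1 : Qk.comp (Polynomial.C c * Polynomial.X) = Pk := by
    refine Polynomial.eq_of_infinite_eval_eq _ _ ((Set.Ici_infinite (0 : ℝ)).mono ?_)
    intro y hy
    have := hγ y hy
    rw [hγlin y hy] at this
    simpa using this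
  have hder : Qk.derivative.comp (Polynomial.C c * Polynomial.X) ≠ 0 := by
    intro h0
    apply hQk
    apply Polynomial.natDegree_eq_zero_of_derivative_eq_zero
    ext s
    have := congrArg (fun f => Polynomial.coeff f s) h0
    simp only [Polynomial.comp_C_mul_X_coeff, Polynomial.coeff_zero] at this
    rw [Polynomial.coeff_zero]
    exact (mul_eq_zero.mp this).resolve_right (by positivity)
  have id2 : (homComp qq (k - 1)).comp (Polynomial.C c * Polynomial.X) +
      Qk.derivative.comp (Polynomial.C c * Polynomial.X) * Polynomial.C r = homComp pp (k - 1) := by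
    have hprod : Qk.derivative.comp (Polynomial.C c * Polynomial.X) *
        ((homComp qq (k - 1)).comp (Polynomial.C c * Polynomial.X) +
        Qk.derivative.comp (Polynomial.C c * Polynomial.X) * Polynomial.C r
        - homComp pp (k - 1)) = 0 := by
      refine Polynomial.eq_of_infinite_eval_eq _ _
        ((Set.Icc_infinite (zero_lt_one (α := ℝ))).mono ?_)
      intro y hy
      have := hRconst y hy
      rw [hγlin y hy.1] at this
      simp only [Set.mem_setOf_eq, Polynomial.eval_mul, Polynomial.eval_sub, Polynomial.eval_add,
        Polynomial.eval_comp, Polynomial.eval_C, Polynomial.eval_X, Polynomial.eval_zero]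
      by_cases hz : Polynomial.eval (c * y) (Polynomial.derivative Qk) = 0
      · rw [hz]; simp
      · rw [div_eq_iff hz] at this
        rw [mul_eq_zero]; right; linarith
    exact sub_eq_zero.mp ((mul_eq_zero.mp hprod).resolve_left hder)
  have h1 : ∀ u t, u + t = k → a u t * c ^ u = b u t := by
    intro u t hut
    have := congrArg (fun f => Polynomial.coeff f u) id1
    simp only [Polynomial.comp_C_mul_X_coeff, hQkdef, hPkdef, LRD.homComp_coeff] at this
    rw [if_pos (by omega), if_pos (by omega), show k - u = t by omega] at this
    exact this
  have h2 : ∀ u t, u + t = k - 1 →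
      a u t * c ^ u + a (u + 1) t * (u + 1) * c ^ u * r = b u t := by
    intro u t hut
    have := congrArg (fun f => Polynomial.coeff f u) id2
    simp only [Polynomial.comp_C_mul_X_coeff, Polynomial.coeff_add, Polynomial.coeff_mul_C,
      Polynomial.coeff_derivative, hQkdef, LRD.homComp_coeff] at this
    rw [if_pos (by omega), if_pos (by omega), if_pos (by omega), show k - 1 - u = t by omega,
      show k - (u + 1) = t by omega] at this
    exact this
  have he := LRD.ee_zero k hk a b c r haz hbz h1 h2
  obtain ⟨s₀, t₀, hs₀, hst, hpos⟩ : ∃ s₀ t₀, 1 ≤ s₀ ∧ s₀ + t₀ = k ∧ 0 < a s₀ t₀ := by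
    refine ⟨Qk.natDegree, k - Qk.natDegree, by omega, ?_⟩
    have hne : Qk.coeff Qk.natDegree ≠ 0 := by
      rw [Polynomial.coeff_natDegree, Polynomial.leadingCoeff_ne_zero]
      intro h; rw [h] at hQk; simp at hQk
    rw [hQkdef, LRD.homComp_coeff, ← hQkdef] at hne
    by_cases hle : Qk.natDegree ≤ k
    · rw [if_pos hle] at hne
      exact ⟨by omega, lt_of_le_of_ne (ha _ _) hne.symm⟩
    · rw [if_neg hle] at hne; exact absurd rfl hne
  have hoff := LRD.off_line k hk a b ha c r hc s₀ t₀ hs₀ hst hpos he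
  have hpowN : ∀ N : ℕ, (N : ℝ) ≤ (N : ℝ) ^ (k - 1) := by
    intro N
    exact_mod_cast Nat.le_self_pow (by omega) N
  by_cases hirr : Irrational c
  · left
    apply LRD.exploding_of
    intro δ hδ hδ1
    obtain ⟨η, hη, N₁, hcard⟩ := LRD.card_irr c r hirr δ hδ
    obtain ⟨W, hW, N₂, hWb⟩ := hoff η hη δ hδ
    refine ⟨W, hW, max N₁ N₂, fun _ n => ∃ m : ℕ, |(m : ℝ) - (c * n + r)| < η, ?_, ?_⟩
    · intro N hN S hS hSB
      exact hcard N (lt_of_le_of_lt (le_max_left _ _) hN) S hS hSB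
    · intro N hN n hn hnN hB m _
      push Not at hB
      rw [hq, hp]
      exact (mul_le_mul_of_nonneg_left (hpowN N) hW.le).trans
        (hWb N (lt_of_le_of_lt (le_max_right _ _) hN) n hn hnN m (hB m))
  obtain ⟨cq, hcq⟩ : ∃ cq : ℚ, (cq : ℝ) = c := by
    unfold Irrational at hirr
    push Not at hirr
    exact hirr
  obtain ⟨η, hη, hgap⟩ := LRD.rat_gap c r cq hcq
  by_cases hex : ∃ n m : ℕ, 0 < n ∧ 0 < m ∧ (m : ℝ) = c * n + r
  swap
  · left
    apply LRD.exploding_of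
    intro δ hδ hδ1
    obtain ⟨W, hW, N₂, hWb⟩ := hoff η hη δ hδ
    refine ⟨W, hW, N₂, fun _ _ => False, ?_, ?_⟩
    · intro N hN S hS hSB
      rw [Finset.eq_empty_of_forall_notMem hSB]
      push_cast [Finset.card_empty]; positivity
    · intro N hN n hn hnN hB m hm
      have hN0 : (0 : ℝ) < N := by exact_mod_cast (by omega)
      have hn0 : 0 < n := by
        have : (0 : ℝ) < n := lt_of_lt_of_le (by positivity) hn
        exact_mod_cast this
      rw [hq, hp]
      refine (mul_le_mul_of_nonneg_left (hpowN N) hW.le).trans (hWb N hN n hn hnN m ?_)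
      exact (hgap n m).resolve_left fun h => hex ⟨n, m, hn0, hm, h⟩
  obtain ⟨n₀, m₀, hn₀, hm₀, hnm⟩ := hex
  have honline : ∀ n m N : ℕ, (m : ℝ) = c * n + r →
      (bEval qq m N : ℝ) - (bEval pp n N : ℝ) = LRD.bsum k (LRD.ee k a b c r) n N := by
    intro n m N h
    rw [hq, hp, h, LRD.diff_eq]
  by_cases hconst : ∀ u t, 0 < u + t → LRD.ee k a b c r u t = 0
  · right
    have hcst := LRD.const_of k _ hconst
    have hd : ∀ n N m : ℕ, (m : ℝ) = c * n + r →
        (bEval qq m N : ℤ) - (bEval pp n N : ℤ) = (bEval qq m₀ 1 : ℤ) - (bEval pp n₀ 1 : ℤ) := by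
      intro n N m h
      have e1 := honline n m N h
      have e2 := honline n₀ m₀ 1 hnm
      rw [hcst] at e1 e2
      have e3 := e1.trans e2.symm
      exact_mod_cast e3
    refine ⟨⟨cq, hcq⟩, ⟨m₀ - cq * n₀, ?_⟩, (bEval qq m₀ 1 : ℤ) - (bEval pp n₀ 1 : ℤ),
      fun n N m _ _ _ h => hd n N m h, ?_⟩
    · push_cast; rw [hcq]; linarith
    · intro δ hδ hδ1
      obtain ⟨W, hW, N₂, hWb⟩ := hoff η hη δ hδ
      refine ⟨W, hW, N₂, fun N hN n hn hnN m hm => ?_⟩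
      rcases hgap n m with h | h
      · exact Or.inl ⟨h, hd n N m h⟩
      · right
        rw [hq, hp]
        exact hWb N hN n hn hnN m h
  · left
    push Not at hconst
    obtain ⟨u₁, t₁, hut, hne⟩ := hconst
    apply LRD.exploding_of
    intro δ hδ hδ1
    obtain ⟨W, hW, N₂, hWb⟩ := hoff η hη δ hδ
    obtain ⟨C, hC, N₁, B, hB1, hB2⟩ := LRD.nonconst_large k (LRD.ee k a b c r)
      (fun u t h => he u t (by omega)) u₁ t₁ hut hne δ hδ
    refine ⟨min C W, lt_min hC hW, max N₁ N₂, B, ?_, ?_⟩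
    · intro N hN
      exact hB1 N (lt_of_le_of_lt (le_max_left _ _) hN)
    · intro N hN n hn hnN hB m hm
      rcases hgap n m with h | h
      · rw [honline n m N h]
        refine le_trans ?_ (hB2 N (lt_of_le_of_lt (le_max_left _ _) hN) n hnN hB)
        gcongr; exact min_le_left _ _
      · rw [hq, hp]
        refine le_trans ?_ (hWb N (lt_of_le_of_lt (le_max_right _ _) hN) n hn hnN m h)
        exact mul_le_mul (min_le_right _ _) (hpowN N) (by positivity) hW.le
end
end

section
/- Distance of an integer from an a-th root: Let a ≥ 2 be an integer, let m and N be positive integers with m ≤ N, and let A be a nonnegative integer with A^{1/a} ≤ N and m^a ≠ A. Then |m − A^{1/a}| ≥ (1/a)·N^{−(a−1)}. -/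
/-- Distance of an integer from an `a`-th root: if `a ≥ 2`, `1 ≤ m ≤ N`,
`A^{1/a} ≤ N` and `m^a ≠ A` then `|m − A^{1/a}| ≥ (1/a)·N^{−(a−1)}`. -/
theorem dist_from_ath_root
    (a : ℕ) (ha : 2 ≤ a) (m N : ℕ) (hm : 0 < m) (hN : 0 < N) (hmN : m ≤ N)
    (A : ℕ) (hA : (A : ℝ) ^ ((1 : ℝ) / a) ≤ (N : ℝ)) (hne : m ^ a ≠ A) :
    (1 / (a : ℝ)) * (N : ℝ) ^ (-((a : ℝ) - 1)) ≤ |(m : ℝ) - (A : ℝ) ^ ((1 : ℝ) / a)| := by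
  have hx0 : (0 : ℝ) ≤ (A : ℝ) ^ ((1 : ℝ) / a) := by positivity
  have hxa : ((A : ℝ) ^ ((1 : ℝ) / a)) ^ a = A := by
    rw [one_div]
    exact Real.rpow_inv_natCast_pow (Nat.cast_nonneg A) (by omega)
  generalize (A : ℝ) ^ ((1 : ℝ) / a) = x at *
  have hNpos : (0 : ℝ) < N := by exact_mod_cast hN
  have hapos : (0 : ℝ) < a := by
    have : 0 < a := by omega
    exact_mod_cast this
  have hmN' : (m : ℝ) ≤ N := by exact_mod_cast hmN
  have h1 : (1 : ℝ) ≤ |(m : ℝ) ^ a - x ^ a| := by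
    rw [hxa]
    have h : (1 : ℤ) ≤ |(m : ℤ) ^ a - A| := by
      apply Int.one_le_abs
      intro h
      apply hne
      have : (m : ℤ) ^ a = A := by linarith
      exact_mod_cast this
    exact_mod_cast h
  have h2 := abs_pow_sub_pow_le (m : ℝ) x a
  have h3 : max |(m : ℝ)| |x| ^ (a - 1) ≤ (N : ℝ) ^ (a - 1) := by
    apply pow_le_pow_left₀ (le_max_of_le_left (abs_nonneg _))
    rw [abs_of_nonneg hx0, abs_of_nonneg (Nat.cast_nonneg m)]
    exact max_le hmN' hA
  have h4 : (1 : ℝ) ≤ |(m : ℝ) - x| * a * (N : ℝ) ^ (a - 1) :=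
    h1.trans (h2.trans (mul_le_mul_of_nonneg_left h3 (by positivity)))
  have h5 : (N : ℝ) ^ (-((a : ℝ) - 1)) = ((N : ℝ) ^ (a - 1))⁻¹ := by
    rw [Real.rpow_neg hNpos.le, ← Real.rpow_natCast, Nat.cast_sub (by omega), Nat.cast_one]
  rw [h5, one_div, ← mul_inv, inv_le_iff_one_le_mul₀ (by positivity)]
  linarith
end

section
/- Ordering proposition for bivariate polynomial arrays: Let q_1,…,q_ℓ be bivariate polynomials with nonnegative integer coefficients, none depending only on the second variable N, with deg q_i ≤ deg q_{i+1}, no constant difference q_i − q_j (i ≠ j), and let r_0 ∈ (0,1) be such that for all i,j with deg q_i > deg q_j and all sufficiently large N, min over integers N^{r_0} ≤ n,m ≤ N of (q_i(n,N) − q_j(m,N)) is at least N. Then there exist constants r_1 ∈ (0,1), c > 0, A, B > 0, sets B_N ⊆ [1,N] containing [1, N^{r_0}] with |B_N| ≤ A·N^{r_1}, and, for each permutation ε of {1,…,ℓ}, finitely many constants 0 ≤ a_{j,ε} ≤ b_{j,ε} ≤ 1 (j = 1,…,l_ε) independent of N, such that: the intervals (a_{j,ε}N, b_{j,ε}N)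 are pairwise disjoint (over all j and ε); the sets I_ε(N) = ∪_{j=1}^{l_ε} (a_{j,ε}N + B·N^{r_1}, b_{j,ε}N − N^{r_1}) ⊆ [1,N] are pairwise disjoint and their union covers [1,N] \ B_N; and for all sufficiently large N and every integer n ∈ I_ε(N) with n ≥ N^{r_1}: q_{ε(1)}(n,N) < q_{ε(2)}(n,N) < … < q_{ε(ℓ)}(n,N), and whenever q_{ε(i)} and q_{ε(i+1)} have the same degree k > 1 one has q_{ε(i+1)}(n,N) ≥ q_{ε(i)}(n,N) + c·N^{1/2}. -/
noncomputable section

/-- The polynomial `q(xT,T)` as a polynomial in `T` with coefficients polynomials in `x`. -/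
def bE (Q : Polynomial (Polynomial ℕ)) : Polynomial (Polynomial ℝ) :=
  Q.eval₂ (Polynomial.eval₂RingHom (Nat.castRingHom _) Polynomial.X)
    (Polynomial.C Polynomial.X * Polynomial.X)

/-- Real evaluation. -/
def bH (Q : Polynomial (Polynomial ℕ)) (y T : ℝ) : ℝ :=
  Q.eval₂ (Polynomial.eval₂RingHom (Nat.castRingHom ℝ) T) y

lemma bH_cast (Q : Polynomial (Polynomial ℕ)) (n N : ℕ) : bH Q n N = (bEval Q n N : ℝ) := by
  unfold bH bEval
  rw [Polynomial.eval_map]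
  have := Polynomial.hom_eval₂ Q (Polynomial.evalRingHom N) (Nat.castRingHom ℝ) n
  simp only [eq_natCast] at this
  rw [this]
  congr 1
  ext <;> simp

lemma bE_eval (Q : Polynomial (Polynomial ℕ)) (x T : ℝ) :
    ((bE Q).eval (Polynomial.C T)).eval x = bH Q (x * T) T := by
  unfold bE bH
  have := Polynomial.hom_eval₂ Q
    (Polynomial.eval₂RingHom (Nat.castRingHom (Polynomial (Polynomial ℝ))) Polynomial.X)
    ((Polynomial.evalRingHom x).comp (Polynomial.evalRingHom (Polynomial.C T)))
    (Polynomial.C Polynomial.X * Polynomial.X)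
  simp only [RingHom.comp_apply, Polynomial.coe_evalRingHom] at this
  rw [this]
  congr 1
  · ext <;> simp
  · simp only [Polynomial.eval_mul, Polynomial.eval_C, Polynomial.eval_X]

lemma bH_cont (Q : Polynomial (Polynomial ℕ)) (y : ℝ) : Continuous (fun T => bH Q y T) := by
  unfold bH
  simp only [Polynomial.eval₂_eq_sum_range]
  refine continuous_finsetSum _ fun k _ => ?_
  refine Continuous.mul ?_ continuous_const
  simp only [Polynomial.coe_eval₂RingHom, Polynomial.eval₂_eq_sum_range]
  fun_prop

lemma bE_pos (P Q : Polynomial (Polynomial ℕ))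
    (h : ¬ ∃ c : ℤ, ∀ n N : ℕ, (bEval P n N : ℤ) - (bEval Q n N : ℤ) = c) :
    0 < (bE P - bE Q).natDegree := by
  by_contra h0
  have h0 : (bE P - bE Q).natDegree = 0 := by omega
  apply h
  obtain ⟨e, he⟩ := Polynomial.natDegree_eq_zero.1 h0
  have key : ∀ x T : ℝ, bH P (x * T) T - bH Q (x * T) T = e.eval x := by
    intro x T
    rw [← bE_eval, ← bE_eval, ← Polynomial.eval_sub, ← Polynomial.eval_sub, ← he]
    simp
  have key2 : ∀ x : ℝ, e.eval x = bH P 0 0 - bH Q 0 0 := by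
    intro x
    rw [← key x 0]; simp
  have key3 : ∀ y T : ℝ, T ≠ 0 → bH P y T - bH Q y T = bH P 0 0 - bH Q 0 0 := by
    intro y T hT
    have := key (y / T) T
    rw [div_mul_cancel₀ _ hT, key2] at this
    exact this
  have key4 : ∀ y T : ℝ, bH P y T - bH Q y T = bH P 0 0 - bH Q 0 0 := by
    intro y T
    have : (fun T => bH P y T - bH Q y T) = fun _ => bH P 0 0 - bH Q 0 0 := by
      refine Continuous.ext_on (dense_compl_singleton (0 : ℝ))
        ((bH_cont P y).sub (bH_cont Q y)) continuous_const ?_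
      intro T hT
      exact key3 y T hT
    exact congrFun this T
  refine ⟨(bEval P 0 0 : ℤ) - bEval Q 0 0, fun n N => ?_⟩
  have h1 := key4 n N
  have h2 := bH_cast P 0 0
  have h3 := bH_cast Q 0 0
  simp only [Nat.cast_zero] at h2 h3
  rw [bH_cast, bH_cast, h2, h3] at h1
  exact_mod_cast h1

lemma poly_bdd (f : Polynomial ℝ) : ∃ C : ℝ, 0 ≤ C ∧ ∀ x ∈ Set.Icc (0:ℝ) 1, |f.eval x| ≤ C := by
  obtain ⟨C, hC⟩ := (isCompact_Icc (a := (0:ℝ)) (b := 1)).exists_bound_of_continuousOn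
    (f := fun x => f.eval x) f.continuous.continuousOn
  refine ⟨|C|, abs_nonneg _, fun x hx => (hC x hx).trans (le_abs_self _)⟩

lemma expand_bound (E : Polynomial (Polynomial ℝ)) (hE : 0 < E.natDegree) :
    ∃ C : ℝ, 0 ≤ C ∧ ∀ x ∈ Set.Icc (0:ℝ) 1, ∀ T : ℝ, 1 ≤ T →
      |(E.eval (Polynomial.C T)).eval x - T ^ E.natDegree * E.leadingCoeff.eval x|
        ≤ C * T ^ (E.natDegree - 1) := by
  choose C hC0 hC using fun d => poly_bdd (E.coeff d)
  refine ⟨∑ d ∈ Finset.range E.natDegree, C d, Finset.sum_nonneg fun d _ => hC0 d, ?_⟩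
  intro x hx T hT
  have : (E.eval (Polynomial.C T)).eval x - T ^ E.natDegree * E.leadingCoeff.eval x
      = ∑ d ∈ Finset.range E.natDegree, (E.coeff d).eval x * T ^ d := by
    rw [Polynomial.eval_eq_sum_range (p := E), Finset.sum_range_succ, Polynomial.eval_add,
      Polynomial.eval_finsetSum]
    simp
    ring
  rw [this, Finset.sum_mul]
  refine (Finset.abs_sum_le_sum_abs _ _).trans (Finset.sum_le_sum fun d hd => ?_)
  have hd := Finset.mem_range.1 hd
  rw [abs_mul, abs_of_nonneg (by positivity : (0:ℝ) ≤ T ^ d)]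
  exact mul_le_mul (hC d x hx) (pow_le_pow_right₀ hT (by omega)) (by positivity) (hC0 d)

lemma lower_bound (f : Polynomial ℝ) (hf : f ≠ 0) :
    ∃ δ : ℝ, 0 < δ ∧ ∀ x ∈ Set.Icc (0:ℝ) 1, ∀ s : ℝ, 0 < s → s ≤ 1 →
      (∀ ρ, f.IsRoot ρ → s ≤ |x - ρ|) → δ * s ^ f.natDegree ≤ |f.eval x| := by
  obtain ⟨q, hq1, hq2, hq3⟩ := Polynomial.exists_prod_multiset_X_sub_C_mul f
  have hq0 : q ≠ 0 := by rintro rfl; simp at hq1; exact hf hq1.symm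
  have hqc : ContinuousOn (fun x => |q.eval x|) (Set.Icc (0:ℝ) 1) := by fun_prop
  obtain ⟨x0, hx0, hmin⟩ := (isCompact_Icc (a := (0:ℝ)) (b := 1)).exists_isMinOn
    ⟨0, by simp⟩ hqc
  have hpos : 0 < |q.eval x0| := by
    rw [abs_pos]
    intro h
    have : x0 ∈ q.roots := (Polynomial.mem_roots hq0).2 h
    rw [hq3] at this
    simp at this
  refine ⟨|q.eval x0|, hpos, fun x hx s hs hs1 hroot => ?_⟩
  have h1 : |q.eval x0| ≤ |q.eval x| := hmin hx
  have h2 : ∀ M : Multiset ℝ, (∀ ρ ∈ M, s ≤ |x - ρ|) →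
      s ^ M.card ≤ |((M.map fun a => Polynomial.X - Polynomial.C a).prod).eval x| := by
    intro M
    induction M using Multiset.induction_on with
    | empty => simp
    | cons a M ih =>
      intro h
      simp only [Multiset.card_cons, Multiset.map_cons, Multiset.prod_cons, Polynomial.eval_mul,
        abs_mul, Polynomial.eval_sub, Polynomial.eval_X, Polynomial.eval_C]
      rw [pow_succ, mul_comm]
      exact mul_le_mul (h a (by simp)) (ih fun ρ hρ => h ρ (by simp [hρ])) (by positivity)
        (abs_nonneg _)
  have h3 := h2 f.roots fun ρ hρ => hroot ρ (Polynomial.isRoot_of_mem_roots hρ)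
  have h4 : s ^ f.natDegree ≤ s ^ f.roots.card :=
    pow_le_pow_of_le_one hs.le hs1 (Polynomial.card_roots' f)
  have h5 : |f.eval x| = |((f.roots.map fun a => Polynomial.X - Polynomial.C a).prod).eval x|
      * |q.eval x| := by
    conv_lhs => rw [← hq1]
    rw [Polynomial.eval_mul, abs_mul]
  rw [h5, mul_comm]
  exact mul_le_mul (h4.trans h3) h1 hpos.le (abs_nonneg _)

open Filter in
lemma pair_sample (E : Polynomial (Polynomial ℝ)) (hE : 0 < E.natDegree) (x : ℝ)
    (hx : x ∈ Set.Icc (0:ℝ) 1) :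
    ∀ᶠ T : ℝ in atTop, (0 < E.leadingCoeff.eval x → 0 < (E.eval (Polynomial.C T)).eval x) ∧
      (E.leadingCoeff.eval x < 0 → (E.eval (Polynomial.C T)).eval x < 0) := by
  obtain ⟨C, hC0, hC⟩ := expand_bound E hE
  set g := E.leadingCoeff.eval x
  by_cases hg : g = 0
  · simp [hg]
  have hg' : 0 < |g| := abs_pos.2 hg
  filter_upwards [eventually_ge_atTop 1, eventually_gt_atTop (C / |g|)] with T hT1 hT2
  have h := abs_le.1 (hC x hx T hT1)
  have h2 : C < |g| * T := by rwa [div_lt_iff₀' hg'] at hT2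
  have h3 : 0 < T ^ (E.natDegree - 1) := by positivity
  have h4 : T ^ E.natDegree = T ^ (E.natDegree - 1) * T := by
    rw [← pow_succ]; congr 1; omega
  rw [h4] at h
  constructor
  · intro hp
    rw [abs_of_pos hp] at h2
    nlinarith [mul_lt_mul_of_pos_right h2 h3, h.1]
  · intro hp
    rw [abs_of_neg hp] at h2
    nlinarith [mul_lt_mul_of_pos_right h2 h3, h.2]

open Filter in
lemma pair_gap (E : Polynomial (Polynomial ℝ)) (hE : 0 < E.natDegree) (r : ℝ) (hr1 : r < 1)
    (hr : (1 - r) * E.leadingCoeff.natDegree ≤ 1 / 4) :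
    ∀ᶠ T : ℝ in atTop, ∀ x ∈ Set.Icc (0:ℝ) 1,
      (∀ ρ, E.leadingCoeff.IsRoot ρ → T ^ (r - 1) ≤ |x - ρ|) →
      (0 < E.leadingCoeff.eval x → T ^ ((1:ℝ)/2) ≤ (E.eval (Polynomial.C T)).eval x) ∧
      (E.leadingCoeff.eval x < 0 → (E.eval (Polynomial.C T)).eval x ≤ - T ^ ((1:ℝ)/2)) := by
  obtain ⟨C, hC0, hC⟩ := expand_bound E hE
  have hf : E.leadingCoeff ≠ 0 := by
    rw [Polynomial.leadingCoeff_ne_zero]; rintro rfl; simp at hE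
  obtain ⟨δ, hδ, hlow⟩ := lower_bound _ hf
  set f := E.leadingCoeff with hfdef
  have ht : Tendsto (fun T : ℝ => T ^ ((1:ℝ)/4)) atTop atTop := tendsto_rpow_atTop (by norm_num)
  filter_upwards [eventually_ge_atTop 1, ht.eventually_ge_atTop ((1 + C) / δ)] with T hT1 hT2
  intro x hx hroot
  have hT0 : 0 < T := by linarith
  have hs1 : T ^ (r - 1) ≤ 1 := Real.rpow_le_one_of_one_le_of_nonpos hT1 (by linarith)
  have h1 := hlow x hx (T ^ (r-1)) (by positivity) hs1 hroot
  have h2 : T ^ (-(1:ℝ)/4) ≤ (T ^ (r-1)) ^ f.natDegree := by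
    rw [← Real.rpow_natCast, ← Real.rpow_mul hT0.le]
    exact Real.rpow_le_rpow_of_exponent_le hT1 (by linarith)
  have h3 : δ * T ^ (-(1:ℝ)/4) ≤ |f.eval x| := le_trans (by gcongr) h1
  -- |f x| * T ≥ δ T^{3/4} ≥ (1+C) T^{1/2} ≥ T^{1/2} + C
  have h4 : T ^ ((1:ℝ)/2) + C ≤ |f.eval x| * T := by
    have e1 : T ^ (-(1:ℝ)/4) * T = T ^ ((1:ℝ)/4) * T ^ ((1:ℝ)/2) := by
      rw [← Real.rpow_add hT0]
      nth_rewrite 2 [← Real.rpow_one T]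
      rw [← Real.rpow_add hT0]; norm_num
    have e2 : 1 ≤ T ^ ((1:ℝ)/2) := Real.one_le_rpow hT1 (by norm_num)
    have e3 : 1 + C ≤ δ * T ^ ((1:ℝ)/4) := by rwa [div_le_iff₀' hδ] at hT2
    have e4 : δ * T ^ (-(1:ℝ)/4) * T ≤ |f.eval x| * T := by gcongr
    rw [mul_assoc, e1, ← mul_assoc] at e4
    have e5 : (1 + C) * T ^ ((1:ℝ)/2) ≤ δ * T ^ ((1:ℝ)/4) * T ^ ((1:ℝ)/2) := by gcongr
    nlinarith
  have h := abs_le.1 (hC x hx T hT1)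
  have h5 : 1 ≤ T ^ (E.natDegree - 1) := one_le_pow₀ hT1
  have h6 : T ^ E.natDegree = T ^ (E.natDegree - 1) * T := by
    rw [← pow_succ]; congr 1; omega
  rw [h6] at h
  have h7 : 0 ≤ T ^ ((1:ℝ)/2) := by positivity
  have h8 : (T ^ ((1:ℝ)/2) + C) * T ^ (E.natDegree - 1)
      ≤ |f.eval x| * T * T ^ (E.natDegree - 1) := by gcongr
  have h9 : T ^ ((1:ℝ)/2) ≤ T ^ ((1:ℝ)/2) * T ^ (E.natDegree - 1) := le_mul_of_one_le_right h7 h5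
  constructor
  · intro hp
    rw [abs_of_pos hp] at h8
    nlinarith [h.1]
  · intro hp
    rw [abs_of_neg hp] at h8
    nlinarith [h.2]

lemma sign_const (f : Polynomial ℝ) (s t : ℝ) (h : ∀ u ∈ Set.Ioo s t, f.eval u ≠ 0)
    (x y : ℝ) (hx : x ∈ Set.Ioo s t) (hy : y ∈ Set.Ioo s t) (hpos : 0 < f.eval x) :
    0 < f.eval y := by
  by_contra hn
  have h1 := intermediate_value_uIcc (a := x) (b := y) (f := fun x => f.eval x)
    f.continuous.continuousOn
  obtain ⟨u, hu, hu0⟩ := h1 (show (0:ℝ) ∈ Set.uIcc (f.eval x) (f.eval y) from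
    Set.mem_uIcc.2 (Or.inr ⟨not_lt.1 hn, hpos.le⟩))
  exact h u (Set.ordConnected_Ioo.uIcc_subset hx hy hu) hu0

lemma card_near (c w : ℝ) (hw : 1 ≤ w) (F : Finset ℕ)
    (hF : ∀ n ∈ F, c - w ≤ n ∧ (n:ℝ) ≤ c + w) : (F.card : ℝ) ≤ 3 * w := by
  have h1 : F.map Nat.castEmbedding ⊆ Finset.Icc ⌈c - w⌉ ⌊c + w⌋ := by
    intro z hz
    simp only [Finset.mem_map, Nat.castEmbedding_apply] at hz
    obtain ⟨n, hn, rfl⟩ := hz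
    rw [Finset.mem_Icc, Int.ceil_le, Int.le_floor]
    exact_mod_cast hF n hn
  have h2 := Finset.card_le_card h1
  rw [Finset.card_map, Int.card_Icc] at h2
  have h3 : (F.card : ℝ) ≤ ((⌊c + w⌋ + 1 - ⌈c - w⌉).toNat : ℝ) := by exact_mod_cast h2
  refine h3.trans ?_
  have h4 : (((⌊c + w⌋ + 1 - ⌈c - w⌉).toNat : ℤ) : ℝ) = ((max (⌊c + w⌋ + 1 - ⌈c - w⌉) 0 : ℤ) : ℝ) := by
    rw [Int.toNat_eq_max]
  rw [Int.cast_natCast] at h4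
  rw [h4]
  push_cast
  refine max_le ?_ (by linarith)
  have := Int.floor_le (c + w)
  have := Int.le_ceil (c - w)
  linarith

/-- Ordering proposition for bivariate polynomial arrays
(Proposition 5.1 of the paper). -/
theorem ordering_of_bivariate_polynomial_arrays
    (ℓ : ℕ) (hℓ : 0 < ℓ)
    (Q : Fin ℓ → Polynomial (Polynomial ℕ))
    (hdep : ∀ i, 0 < (Q i).natDegree)  -- no q_i depends only on N
    (hdegmono : ∀ i j : Fin ℓ, i ≤ j → diagDeg (Q i) ≤ diagDeg (Q j))
    (hdiffnc : ∀ i j : Fin ℓ, i ≠ j →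
      ¬ ∃ c : ℤ, ∀ n N : ℕ, (bEval (Q i) n N : ℤ) - (bEval (Q j) n N : ℤ) = c)
    (r₀ : ℝ) (hr₀0 : 0 < r₀) (hr₀1 : r₀ < 1)
    (hr₀ : ∀ i j : Fin ℓ, diagDeg (Q j) < diagDeg (Q i) →
      ∃ N₀ : ℕ, ∀ N : ℕ, N₀ ≤ N → ∀ n m : ℕ,
        (N : ℝ) ^ r₀ ≤ (n : ℝ) → n ≤ N → (N : ℝ) ^ r₀ ≤ (m : ℝ) → m ≤ N →
          (N : ℝ) ≤ (bEval (Q i) n N : ℝ) - (bEval (Q j) m N : ℝ)) :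
    ∃ r₁ : ℝ, 0 < r₁ ∧ r₁ < 1 ∧ ∃ c : ℝ, 0 < c ∧ ∃ A : ℝ, 0 < A ∧ ∃ B : ℝ, 0 < B ∧
    ∃ BN : ℕ → Finset ℕ,
    ∃ l : Equiv.Perm (Fin ℓ) → ℕ,
    ∃ a b : (ε : Equiv.Perm (Fin ℓ)) → Fin (l ε) → ℝ,
      -- endpoints lie in [0,1]
      (∀ ε j, 0 ≤ a ε j ∧ a ε j ≤ b ε j ∧ b ε j ≤ 1) ∧
      -- B_N ⊆ [1,N] contains [1, N^{r₀}] and has cardinality at most A·N^{r₁}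
      (∀ N : ℕ, ↑(BN N) ⊆ Set.Icc 1 N) ∧
      (∀ N n : ℕ, 1 ≤ n → (n : ℝ) ≤ (N : ℝ) ^ r₀ → n ≤ N → n ∈ BN N) ∧
      (∀ N : ℕ, ((BN N).card : ℝ) ≤ A * (N : ℝ) ^ r₁) ∧
      -- the intervals (a_{j,ε}N, b_{j,ε}N) are pairwise disjoint
      (∀ x y : (ε : Equiv.Perm (Fin ℓ)) × Fin (l ε), x ≠ y → ∀ N : ℕ,
        Disjoint (Set.Ioo (a x.1 x.2 * N) (b x.1 x.2 * N))
          (Set.Ioo (a y.1 y.2 * N) (b y.1 y.2 * N))) ∧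
      -- each I_ε(N) is contained in [1,N]
      (∀ N : ℕ, ∀ ε, ∀ j, ∀ n : ℕ,
        a ε j * N + B * (N : ℝ) ^ r₁ < (n : ℝ) → (n : ℝ) < b ε j * N - (N : ℝ) ^ r₁ →
          1 ≤ n ∧ n ≤ N) ∧
      -- the sets I_ε(N) cover [1,N] \ B_N
      (∀ N : ℕ, ∀ n : ℕ, 1 ≤ n → n ≤ N → n ∉ BN N →
        ∃ ε j, a ε j * N + B * (N : ℝ) ^ r₁ < (n : ℝ) ∧
          (n : ℝ) < b ε j * N - (N : ℝ) ^ r₁) ∧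
      -- ordering along each I_ε(N), with a N^{1/2}-gap for equal nonlinear degrees
      ∃ N₁ : ℕ, ∀ N : ℕ, N₁ ≤ N → ∀ ε : Equiv.Perm (Fin ℓ), ∀ n : ℕ,
        (∃ j, a ε j * N + B * (N : ℝ) ^ r₁ < (n : ℝ) ∧
          (n : ℝ) < b ε j * N - (N : ℝ) ^ r₁) →
        (N : ℝ) ^ r₁ ≤ (n : ℝ) →
        (∀ i i' : Fin ℓ, i < i' → bEval (Q (ε i)) n N < bEval (Q (ε i')) n N) ∧
        (∀ i i' : Fin ℓ, (i' : ℕ) = (i : ℕ) + 1 →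
          diagDeg (Q (ε i)) = diagDeg (Q (ε i')) → 1 < diagDeg (Q (ε i)) →
          (bEval (Q (ε i)) n N : ℝ) + c * (N : ℝ) ^ ((1 : ℝ) / 2)
            ≤ (bEval (Q (ε i')) n N : ℝ)) := by
  classical
  set E : Fin ℓ → Fin ℓ → Polynomial (Polynomial ℝ) := fun i j => bE (Q i) - bE (Q j) with hEdef
  have hE : ∀ i j, i ≠ j → 0 < (E i j).natDegree := fun i j hij => bE_pos _ _ (hdiffnc i j hij)
  set f : Fin ℓ → Fin ℓ → Polynomial ℝ := fun i j => (E i j).leadingCoeff with hfdef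
  have hf : ∀ i j, i ≠ j → f i j ≠ 0 := by
    intro i j hij
    simp only [hfdef]
    rw [Polynomial.leadingCoeff_ne_zero]
    intro h
    have := hE i j hij
    rw [h] at this
    simp at this
  obtain ⟨S, hS0, hS1, hSI, hSr⟩ : ∃ S : Finset ℝ, 0 ∈ S ∧ 1 ∈ S ∧ (∀ u ∈ S, 0 ≤ u ∧ u ≤ 1) ∧
      ∀ i j, i ≠ j → ∀ u, 0 ≤ u → u ≤ 1 → (f i j).IsRoot u → u ∈ S := by
    refine ⟨{0, 1} ∪ ((Finset.univ : Finset (Fin ℓ × Fin ℓ)).biUnion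
      fun p => (f p.1 p.2).roots.toFinset).filter (fun u => 0 ≤ u ∧ u ≤ 1), by simp, by simp, ?_, ?_⟩
    · intro u hu
      simp only [Finset.mem_union, Finset.mem_insert, Finset.mem_singleton,
        Finset.mem_filter] at hu
      rcases hu with (rfl | rfl) | h
      · norm_num
      · norm_num
      · exact h.2
    · intro i j hij u h0 h1 hr
      simp only [Finset.mem_union, Finset.mem_filter, Finset.mem_biUnion]
      right
      refine ⟨⟨(i, j), Finset.mem_univ _, ?_⟩, h0, h1⟩
      rw [Multiset.mem_toFinset, Polynomial.mem_roots (hf i j hij)]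
      exact hr
  set P : Finset (ℝ × ℝ) :=
    (S ×ˢ S).filter (fun p => p.1 < p.2 ∧ ∀ u ∈ S, ¬ (p.1 < u ∧ u < p.2)) with hPdef
  have hP : ∀ p : P, p.1.1 ∈ S ∧ p.1.2 ∈ S ∧ p.1.1 < p.1.2 ∧
      ∀ u ∈ S, ¬ (p.1.1 < u ∧ u < p.1.2) := by
    rintro ⟨p, hp⟩
    simp only [hPdef, Finset.mem_filter, Finset.mem_product] at hp
    exact ⟨hp.1.1, hp.1.2, hp.2.1, hp.2.2⟩
  have hPr : ∀ p : P, ∀ i j, i ≠ j → ∀ u ∈ Set.Ioo p.1.1 p.1.2, (f i j).eval u ≠ 0 := by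
    intro p i j hij u hu h0
    obtain ⟨h1, h2, h3, h4⟩ := hP p
    refine h4 u (hSr i j hij u ?_ ?_ h0) hu
    · exact (hSI _ h1).1.trans hu.1.le
    · exact hu.2.le.trans (hSI _ h2).2
  have hmid : ∀ p : P, (p.1.1 + p.1.2) / 2 ∈ Set.Ioo p.1.1 p.1.2 := by
    intro p
    have := (hP p).2.2.1
    constructor <;> linarith
  have hσ : ∀ p : P, ∃ σ : Equiv.Perm (Fin ℓ), ∀ i i', i < i' →
      0 < (f (σ i') (σ i)).eval ((p.1.1 + p.1.2) / 2) := by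
    intro p
    obtain ⟨h1, h2, h3, h4⟩ := hP p
    have hm := hmid p
    set x := (p.1.1 + p.1.2) / 2
    have hx : x ∈ Set.Icc (0:ℝ) 1 := ⟨(hSI _ h1).1.trans hm.1.le, hm.2.le.trans (hSI _ h2).2⟩
    have hev : ∀ᶠ T : ℝ in Filter.atTop, ∀ i j, i ≠ j →
        (0 < (f i j).eval x → 0 < ((E i j).eval (Polynomial.C T)).eval x) ∧
        ((f i j).eval x < 0 → ((E i j).eval (Polynomial.C T)).eval x < 0) := by
      rw [Filter.eventually_all]; intro i
      rw [Filter.eventually_all]; intro j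
      by_cases hij : i = j
      · simp [hij]
      · filter_upwards [pair_sample (E i j) (hE i j hij) x hx] with T hT _
        exact hT
    obtain ⟨T, hT⟩ := hev.exists
    set v : Fin ℓ → ℝ := fun i => ((bE (Q i)).eval (Polynomial.C T)).eval x with hv
    have hEv : ∀ i j, ((E i j).eval (Polynomial.C T)).eval x = v i - v j := by
      intro i j; simp [hEdef, hv]
    refine ⟨Tuple.sort v, fun i i' hii => ?_⟩
    have hne : Tuple.sort v i' ≠ Tuple.sort v i := by
      intro h; exact hii.ne' ((Tuple.sort v).injective h)
    have hmono : v (Tuple.sort v i) ≤ v (Tuple.sort v i') := Tuple.monotone_sort v hii.le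
    rcases lt_or_gt_of_ne (hPr p _ _ hne x hm) with h | h
    · have := (hT _ _ hne).2 h
      rw [hEv] at this
      linarith
    · exact h
  choose σ hσ using hσ
  obtain ⟨M, hM0, hM⟩ : ∃ M : ℕ, 0 < M ∧ ∀ i j, (f i j).natDegree ≤ M := by
    refine ⟨∑ i, ∑ j, (f i j).natDegree + 1, by omega, fun i j => ?_⟩
    have h1 := Finset.single_le_sum (f := fun j => (f i j).natDegree) (s := Finset.univ)
      (fun _ _ => Nat.zero_le _) (Finset.mem_univ j)
    have h2 := Finset.single_le_sum (f := fun i => ∑ j, (f i j).natDegree) (s := Finset.univ)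
      (fun _ _ => Nat.zero_le _) (Finset.mem_univ i)
    exact (h1.trans h2).trans (Nat.le_succ _)
  obtain ⟨r, hr0, hr1, hrM⟩ : ∃ r : ℝ, r₀ ≤ r ∧ r < 1 ∧ (1 - r) * M ≤ 1 / 4 := by
    have hM' : (0:ℝ) < M := by exact_mod_cast hM0
    refine ⟨max r₀ (1 - 1 / (4 * M)), le_max_left _ _, max_lt hr₀1 ?_, ?_⟩
    · have : (0:ℝ) < 1 / (4 * M) := by positivity
      linarith
    · have h : 1 - max r₀ (1 - 1 / (4 * M)) ≤ 1 / (4 * (M:ℝ)) := by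
        have := le_max_right r₀ (1 - 1 / (4 * (M:ℝ)))
        linarith
      calc _ ≤ 1 / (4 * (M:ℝ)) * M := by gcongr
        _ = 1 / 4 := by field_simp
  have hr00 : 0 < r := hr₀0.trans_le hr0
  -- the permutation data
  set good : ℕ → ℕ → Prop := fun N n =>
    ∃ p : P, p.1.1 * N + 1 * (N:ℝ) ^ r < (n:ℝ) ∧ (n:ℝ) < p.1.2 * N - (N:ℝ) ^ r with hgood
  let e : (ε : Equiv.Perm (Fin ℓ)) → {p : P // σ p = ε} ≃ Fin (Fintype.card {p : P // σ p = ε}) :=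
    fun ε => Fintype.equivFin _
  refine ⟨r, hr00, hr1, 1, one_pos, 3 * S.card + 1, by positivity, 1, one_pos,
    fun N => (Finset.Icc 1 N).filter (fun n => ¬ good N n),
    fun ε => Fintype.card {p : P // σ p = ε},
    fun ε j => ((e ε).symm j).1.1.1, fun ε j => ((e ε).symm j).1.1.2, ?_, ?_, ?_, ?_, ?_, ?_, ?_, ?_⟩
  · intro ε j
    obtain ⟨h1, h2, h3, h4⟩ := hP ((e ε).symm j).1
    exact ⟨(hSI _ h1).1, h3.le, (hSI _ h2).2⟩
  · intro N n hn
    simp only [Finset.coe_filter, Finset.mem_Icc, Set.mem_ofPred_eq] at hn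
    exact hn.1
  · intro N n h1 h2 h3
    simp only [Finset.mem_filter, Finset.mem_Icc]
    refine ⟨⟨h1, h3⟩, ?_⟩
    rintro ⟨p, hp1, hp2⟩
    have hN : (1:ℝ) ≤ N := by exact_mod_cast h1.trans h3
    have h5 : (N:ℝ) ^ r₀ ≤ (N:ℝ) ^ r := Real.rpow_le_rpow_of_exponent_le hN hr0
    have h6 : 0 ≤ p.1.1 * N := mul_nonneg (hSI _ (hP p).1).1 (by linarith)
    linarith
  · intro N
    rcases Nat.eq_zero_or_pos N with rfl | hN
    · have : (0:ℝ) ≤ (3 * S.card + 1) * ((0:ℕ):ℝ) ^ r := by positivity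
      simpa using this
    have hN1 : (1:ℝ) ≤ N := by exact_mod_cast hN
    have hNp : (0:ℝ) < N := by linarith
    have hw : 1 ≤ (N:ℝ) ^ r := Real.one_le_rpow hN1 hr00.le
    set F := (Finset.Icc 1 N).filter (fun n => ¬ good N n)
    have hsub : F ⊆ S.biUnion fun s => F.filter fun n =>
        s * N - (N:ℝ) ^ r ≤ n ∧ (n:ℝ) ≤ s * N + (N:ℝ) ^ r := by
      intro n hn
      have hn' := hn
      simp only [F, Finset.mem_filter, Finset.mem_Icc] at hn'
      obtain ⟨⟨h1, h2⟩, h3⟩ := hn'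
      have h1' : (1:ℝ) ≤ n := by exact_mod_cast h1
      have h2' : (n:ℝ) ≤ N := by exact_mod_cast h2
      have hx0 : (0:ℝ) < n / N := by positivity
      have hx1 : (n:ℝ) / N ≤ 1 := by rw [div_le_one hNp]; exact h2'
      have ne1 : (S.filter (fun u => u < (n:ℝ) / N)).Nonempty := ⟨0, by simp [hS0, hx0]⟩
      have ne2 : (S.filter (fun u => (n:ℝ) / N ≤ u)).Nonempty := ⟨1, by simp [hS1, hx1]⟩
      have m1 := Finset.max'_mem _ ne1
      have m2 := Finset.min'_mem _ ne2
      have l1 := Finset.le_max' (S.filter (fun u => u < (n:ℝ) / N))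
      have l2 := Finset.min'_le (S.filter (fun u => (n:ℝ) / N ≤ u))
      set s := Finset.max' _ ne1
      set t := Finset.min' _ ne2
      rw [Finset.mem_filter] at m1 m2
      have hst : (s, t) ∈ P := by
        simp only [hPdef, Finset.mem_filter, Finset.mem_product]
        refine ⟨⟨m1.1, m2.1⟩, by linarith [m1.2, m2.2], fun u hu hh => ?_⟩
        rcases lt_or_ge u ((n:ℝ) / N) with h | h
        · have := l1 u (by simp [hu, h])
          linarith [hh.1]
        · have := l2 u (by simp [hu, h])
          linarith [hh.2]
      have hs : s * N < n := by rw [← lt_div_iff₀ hNp]; exact m1.2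
      have ht : n ≤ t * N := by rw [← div_le_iff₀ hNp]; exact m2.2
      simp only [Finset.mem_biUnion]
      by_cases hc : (n:ℝ) ≤ s * N + (N:ℝ) ^ r
      · refine ⟨s, m1.1, Finset.mem_filter.2 ⟨hn, by linarith, hc⟩⟩
      · refine ⟨t, m2.1, Finset.mem_filter.2 ⟨hn, ?_, by linarith⟩⟩
        by_contra hc2
        apply h3
        refine ⟨⟨(s, t), hst⟩, ?_, ?_⟩ <;> simp only <;> linarith
    have hc1 := (Finset.card_le_card hsub).trans Finset.card_biUnion_le
    have hc2 : (F.card : ℝ) ≤ ∑ s ∈ S, ((F.filter fun n : ℕ =>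
        s * N - (N:ℝ) ^ r ≤ n ∧ (n:ℝ) ≤ s * N + (N:ℝ) ^ r).card : ℝ) := by exact_mod_cast hc1
    have hc3 : ∑ s ∈ S, ((F.filter fun n : ℕ =>
        s * N - (N:ℝ) ^ r ≤ n ∧ (n:ℝ) ≤ s * N + (N:ℝ) ^ r).card : ℝ)
        ≤ ∑ s ∈ S, 3 * (N:ℝ) ^ r := by
      refine Finset.sum_le_sum fun s _ => card_near (s * N) _ hw _ fun n hn => ?_
      exact (Finset.mem_filter.1 hn).2
    rw [Finset.sum_const, nsmul_eq_mul] at hc3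
    change (F.card : ℝ) ≤ _
    nlinarith
  · intro x y hxy N
    rw [Set.disjoint_left]
    rintro z ⟨hz1, hz2⟩ ⟨hz3, hz4⟩
    apply hxy
    have hNp : (0:ℝ) ≤ N := Nat.cast_nonneg _
    have key : ((e x.1).symm x.2).1 = ((e y.1).symm y.2).1 := by
      obtain ⟨a1, a2, a3, a4⟩ := hP ((e x.1).symm x.2).1
      obtain ⟨b1, b2, b3, b4⟩ := hP ((e y.1).symm y.2).1
      have c1 := lt_of_mul_lt_mul_right (hz1.trans hz4) hNp
      have c2 := lt_of_mul_lt_mul_right (hz3.trans hz2) hNp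
      apply Subtype.ext
      apply Prod.ext
      · rcases lt_trichotomy ((e x.1).symm x.2).1.1.1 ((e y.1).symm y.2).1.1.1 with h | h | h
        · exact absurd ⟨h, c2⟩ (a4 _ b1)
        · exact h
        · exact absurd ⟨h, c1⟩ (b4 _ a1)
      · rcases lt_trichotomy ((e x.1).symm x.2).1.1.2 ((e y.1).symm y.2).1.1.2 with h | h | h
        · exact absurd ⟨c2, h⟩ (b4 _ a2)
        · exact h
        · exact absurd ⟨c1, h⟩ (a4 _ b2)
    obtain ⟨ε, j⟩ := x
    obtain ⟨ε', j'⟩ := y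
    have hεε : ε = ε' := by
      rw [← ((e ε).symm j).2, ← ((e ε').symm j').2, key]
    subst hεε
    have := (e ε).symm.injective (Subtype.ext key)
    exact congrArg (Sigma.mk ε) this
  · intro N ε j n h1 h2
    obtain ⟨a1, a2, a3, a4⟩ := hP ((e ε).symm j).1
    have hNp : (0:ℝ) ≤ N := Nat.cast_nonneg _
    have hw : 0 ≤ (N:ℝ) ^ r := by positivity
    have h3 := mul_nonneg (hSI _ a1).1 hNp
    have h4 := mul_le_mul_of_nonneg_right (hSI _ a2).2 hNp
    constructor
    · have : (0:ℝ) < n := by linarith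
      exact_mod_cast this
    · have : (n:ℝ) ≤ N := by linarith
      exact_mod_cast this
  · intro N n h1 h2 h3
    have hg : good N n := by
      by_contra h
      exact h3 (by simp [h1, h2, h])
    obtain ⟨p, hp⟩ := hg
    refine ⟨σ p, e (σ p) ⟨p, rfl⟩, ?_⟩
    simpa using hp
  · have hev : ∀ᶠ T : ℝ in Filter.atTop, ∀ i j, i ≠ j → ∀ x ∈ Set.Icc (0:ℝ) 1,
        (∀ ρ, (f i j).IsRoot ρ → T ^ (r - 1) ≤ |x - ρ|) →
        (0 < (f i j).eval x → T ^ ((1:ℝ)/2) ≤ ((E i j).eval (Polynomial.C T)).eval x) ∧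
        ((f i j).eval x < 0 → ((E i j).eval (Polynomial.C T)).eval x ≤ - T ^ ((1:ℝ)/2)) := by
      rw [Filter.eventually_all]; intro i
      rw [Filter.eventually_all]; intro j
      by_cases hij : i = j
      · simp [hij]
      · have hd : (1 - r) * ((f i j).natDegree : ℝ) ≤ 1 / 4 := by
          refine le_trans ?_ hrM
          have : ((f i j).natDegree : ℝ) ≤ M := by exact_mod_cast hM i j
          have : 0 ≤ 1 - r := by linarith
          gcongr
        filter_upwards [pair_gap (E i j) (hE i j hij) r hr1 hd] with T hT _
        exact hT
    have hevN := tendsto_natCast_atTop_atTop (R := ℝ) |>.eventually hev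
    obtain ⟨N₁, hN₁⟩ := Filter.eventually_atTop.1 (hevN.and (Filter.eventually_ge_atTop 1))
    refine ⟨N₁, fun N hN ε n => ?_⟩
    rintro ⟨j, hj1, hj2⟩ -
    obtain ⟨hmain, hN1⟩ := hN₁ N hN
    have hpe := ((e ε).symm j).2
    set p := ((e ε).symm j).1
    obtain ⟨a1, a2, a3, a4⟩ := hP p
    have hN1' : (1:ℝ) ≤ N := by exact_mod_cast hN1
    have hNp : (0:ℝ) < N := by linarith
    have hwp : 0 < (N:ℝ) ^ (r - 1) := by positivity
    have hwe : (N:ℝ) ^ r = (N:ℝ) ^ (r - 1) * N := by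
      rw [Real.rpow_sub_one hNp.ne']; field_simp
    set x : ℝ := (n:ℝ) / N with hx
    have hnx : (n:ℝ) = x * N := by rw [hx]; field_simp
    have hx1 : p.1.1 + (N:ℝ) ^ (r - 1) < x := by
      rw [hnx, hwe] at hj1
      refine lt_of_mul_lt_mul_right (a := (N:ℝ)) ?_ hNp.le
      linarith
    have hx2 : x < p.1.2 - (N:ℝ) ^ (r - 1) := by
      rw [hnx, hwe] at hj2
      refine lt_of_mul_lt_mul_right (a := (N:ℝ)) ?_ hNp.le
      linarith
    have hxI : x ∈ Set.Ioo p.1.1 p.1.2 := ⟨by linarith, by linarith⟩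
    have hs0 := (hSI _ a1).1
    have ht1 := (hSI _ a2).2
    have hx01 : x ∈ Set.Icc (0:ℝ) 1 := ⟨by linarith, by linarith⟩
    have hgap : ∀ i i' : Fin ℓ, i < i' →
        (bEval (Q (ε i)) n N : ℝ) + (N : ℝ) ^ ((1 : ℝ) / 2) ≤ (bEval (Q (ε i')) n N : ℝ) := by
      intro i i' hii
      have hne : ε i' ≠ ε i := fun h => hii.ne' (ε.injective h)
      have hpos := hσ p i i' hii
      rw [hpe] at hpos
      have hpos' := sign_const _ _ _ (hPr p _ _ hne) _ x (hmid p) hxI hpos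
      have hroots : ∀ ρ, (f (ε i') (ε i)).IsRoot ρ → (N:ℝ) ^ (r - 1) ≤ |x - ρ| := by
        intro ρ hρ
        by_contra hlt
        rw [not_le, abs_lt] at hlt
        exact hPr p _ _ hne ρ ⟨by linarith [hlt.2], by linarith [hlt.1]⟩ hρ
      have hfin := (hmain _ _ hne x hx01 hroots).1 hpos'
      simp only [hEdef, Polynomial.eval_sub, bE_eval] at hfin
      rw [← hnx, bH_cast, bH_cast] at hfin
      linarith
    refine ⟨fun i i' hii => ?_, fun i i' hii _ _ => ?_⟩
    · have h1 := hgap i i' hii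
      have h2 : 0 < (N : ℝ) ^ ((1 : ℝ) / 2) := by positivity
      have h3 : (bEval (Q (ε i)) n N : ℝ) < (bEval (Q (ε i')) n N : ℝ) := by linarith
      exact_mod_cast h3
    · rw [one_mul]
      exact hgap i i' (by rw [Fin.lt_def]; omega)
end
end
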